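/- arXiv:2206.15414 — 6 statements merged into one kernel-verified Lean document; each statement's English description precedes it below -/
import Mathlib

section
/- Let G be a finite simple graph that has a vertex cover of size k. Then G admits an obstacle representation with at most 1 + k(k−1)/2 + k·2^k obstacles. -/
open scoped Classical

noncomputable section

/-- A simple polygon in the plane, given by `k ≥ 3` pairwise distinct vertices
`p₀, …, p_{k-1}` (indexed cyclically by `ZMod k`): consecutive boundary segments
meet exactly in their shared endpoint, and non-consecutive ones are disjoint. -/
structure SimplePolygon where
  k : ℕ
  three_le : 3 ≤ k
  verts : ZMod k → ℝ × ℝ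
  inj : Function.Injective verts
  consec : ∀ i : ZMod k,
    segment ℝ (verts i) (verts (i + 1)) ∩ segment ℝ (verts (i + 1)) (verts (i + 2)) =
      {verts (i + 1)}
  nonconsec : ∀ i j : ZMod k, j ≠ i → j ≠ i + 1 → i ≠ j + 1 →
    Disjoint (segment ℝ (verts i) (verts (i + 1))) (segment ℝ (verts j) (verts (j + 1)))

/-- The union `C` of the boundary segments of a simple polygon. -/
def SimplePolygon.boundary (P : SimplePolygon) : Set (ℝ × ℝ) :=
  ⋃ i : ZMod P.k, segment ℝ (P.verts i) (P.verts (i + 1))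

/-- The simple polygon as a set: the boundary `C` together with the union `B` of all
bounded connected components of the complement of `C`. -/
def SimplePolygon.toSet (P : SimplePolygon) : Set (ℝ × ℝ) :=
  P.boundary ∪ {x | x ∉ P.boundary ∧ Bornology.IsBounded (connectedComponentIn P.boundaryᶜ x)}

/-- An obstacle representation of a simple graph `G`: an injective placement of the
vertices in general position together with finitely many pairwise disjoint simple
polygons (obstacles) such that edges are unobstructed segments and non-edges are
blocked by some obstacle. -/
structure ObstacleRep {V : Type*} (G : SimpleGraph V) where
  pos : V → ℝ × ℝ
  posInj : Function.Injective pos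
  genPos : ∀ u v w : V, u ≠ v → u ≠ w → v ≠ w →
    ¬ Collinear ℝ ({pos u, pos v, pos w} : Set (ℝ × ℝ))
  numObs : ℕ
  obs : Fin numObs → SimplePolygon
  disj : ∀ i j : Fin numObs, i ≠ j → Disjoint (obs i).toSet (obs j).toSet
  edges_clear : ∀ u v : V, G.Adj u v → ∀ i,
    Disjoint (segment ℝ (pos u) (pos v)) (obs i).toSet
  nonedges_blocked : ∀ u v : V, u ≠ v → ¬ G.Adj u v →
    ∃ i, (segment ℝ (pos u) (pos v) ∩ (obs i).toSet).Nonempty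

/-- Twice the signed area of the triangle `p q r`. -/
def crossProd (p q r : ℝ × ℝ) : ℝ :=
  (q.1 - p.1) * (r.2 - p.2) - (q.2 - p.2) * (r.1 - p.1)

/-- The slope of the line through `p` and `q`. -/
def slopeOf (p q : ℝ × ℝ) : ℝ := (q.2 - p.2) / (q.1 - p.1)

theorem crossProd_eq_zero_of_collinear {p q r : ℝ × ℝ}
    (h : Collinear ℝ ({p, q, r} : Set (ℝ × ℝ))) : crossProd p q r = 0 := by
  obtain ⟨d, hd⟩ := (collinear_iff_of_mem (p₀ := p) (by simp)).1 h
  obtain ⟨a, rfl⟩ := hd q (by simp)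
  obtain ⟨b, rfl⟩ := hd r (by simp)
  simp [crossProd]
  ring

theorem crossProd_of_mem_segment {p q a b x : ℝ × ℝ} (hx : x ∈ segment ℝ a b) :
    ∃ s t : ℝ, 0 ≤ s ∧ 0 ≤ t ∧ s + t = 1 ∧ s • a + t • b = x ∧
      crossProd p q x = s * crossProd p q a + t * crossProd p q b := by
  obtain ⟨s, t, hs, ht, hst, rfl⟩ := hx
  refine ⟨s, t, hs, ht, hst, rfl, ?_⟩
  obtain rfl : s = 1 - t := by linarith
  simp [crossProd]
  ring

theorem crossProd_eq_zero_of_mem_segment {p q x : ℝ × ℝ} (hx : x ∈ segment ℝ p q) :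
    crossProd p q x = 0 := by
  obtain ⟨s, t, -, -, -, -, h⟩ := crossProd_of_mem_segment (p := p) (q := q) hx
  rw [h]
  simp [crossProd]
  right
  ring

theorem ZMod.one_ne_zero_of_three_le {n : ℕ} (hn : 3 ≤ n) : (1 : ZMod n) ≠ 0 := by
  have := (ZMod.natCast_eq_zero_iff 1 n).not.2
    (fun h => by have := Nat.le_of_dvd one_pos h; omega)
  simpa using this

theorem ZMod.two_ne_zero_of_three_le {n : ℕ} (hn : 3 ≤ n) : (2 : ZMod n) ≠ 0 := by
  have := (ZMod.natCast_eq_zero_iff 2 n).not.2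
    (fun h => by have := Nat.le_of_dvd two_pos h; omega)
  simpa using this

/-- A convex polygon: every edge has all the other vertices strictly to its left. -/
def SimplePolygon.ofCrossPos (n : ℕ) (hn : 3 ≤ n) (v : ZMod n → ℝ × ℝ)
    (h : ∀ i l, l ≠ i → l ≠ i + 1 → 0 < crossProd (v i) (v (i + 1)) (v l)) :
    SimplePolygon where
  k := n
  three_le := hn
  verts := v
  inj := by
    have h1 := ZMod.one_ne_zero_of_three_le hn
    have h2 := ZMod.two_ne_zero_of_three_le hn
    intro i l hil
    by_contra hne
    by_cases hl : l = i + 1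
    · subst hl
      have := h i (i + 2) (by simpa using h2) (fun hh => h1 (by linear_combination hh))
      rw [← hil] at this
      simp [crossProd] at this
    · have := h i l (Ne.symm hne) hl
      rw [← hil] at this
      simp [crossProd] at this
  consec := by
    have h1 := ZMod.one_ne_zero_of_three_le hn
    have h2 := ZMod.two_ne_zero_of_three_le hn
    intro i
    apply Set.Subset.antisymm
    · rintro x ⟨hx, hx'⟩
      have h0 := crossProd_eq_zero_of_mem_segment hx
      obtain ⟨s, t, hs, ht, hst, hxe, hc⟩ :=
        crossProd_of_mem_segment (p := v i) (q := v (i + 1)) hx'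
      have hp := h i (i + 2) (by simpa using h2) (fun hh => h1 (by linear_combination hh))
      have hz : crossProd (v i) (v (i + 1)) (v (i + 1)) = 0 := by simp [crossProd]; ring
      rw [hz, h0] at hc
      have ht0 : t = 0 := by
        rcases mul_eq_zero.1 (show t * crossProd (v i) (v (i + 1)) (v (i + 2)) = 0 by linarith)
          with h | h
        · exact h
        · exact absurd h hp.ne'
      obtain rfl : s = 1 := by linarith
      simp [← hxe, ht0]
    · rintro x rfl
      exact ⟨right_mem_segment _ _ _, left_mem_segment _ _ _⟩
  nonconsec := by
    intro i j hji hji1 hij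
    rw [Set.disjoint_left]
    intro x hx hx'
    have h0 := crossProd_eq_zero_of_mem_segment hx
    obtain ⟨s, t, hs, ht, hst, hxe, hc⟩ :=
      crossProd_of_mem_segment (p := v i) (q := v (i + 1)) hx'
    have hp := h i j hji hji1
    have hq := h i (j + 1) (Ne.symm hij) (fun hh => hji (by linear_combination hh))
    rcases hs.eq_or_lt with rfl | hs'
    · obtain rfl : t = 1 := by linarith
      linarith
    · nlinarith [mul_pos hs' hp, mul_nonneg ht hq.le]

/-- A half-plane containing all vertices of a polygon contains the polygon. -/
theorem SimplePolygon.halfPlane_of_mem_toSet (P : SimplePolygon) {a b c : ℝ}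
    (h : ∀ i, c ≤ a * (P.verts i).1 + b * (P.verts i).2) {x : ℝ × ℝ} (hx : x ∈ P.toSet) :
    c ≤ a * x.1 + b * x.2 := by
  have hbd : ∀ y ∈ P.boundary, c ≤ a * y.1 + b * y.2 := by
    intro y hy
    obtain ⟨i, s, t, hs, ht, hst, rfl⟩ := Set.mem_iUnion.1 hy
    have h1 := mul_le_mul_of_nonneg_left (h i) hs
    have h2 := mul_le_mul_of_nonneg_left (h (i + 1)) ht
    have : c = s * c + t * c := by rw [← add_mul, hst, one_mul]
    simp
    linarith
  rcases hx with hx | ⟨hx, hbdd⟩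
  · exact hbd x hx
  by_contra! hlt
  have hab : 0 < a ^ 2 + b ^ 2 := by
    by_contra! h0
    obtain rfl : a = 0 := by nlinarith [sq_nonneg a, sq_nonneg b]
    obtain rfl : b = 0 := by nlinarith [sq_nonneg b]
    have := h 0
    simp at this hlt
    linarith
  set H : Set (ℝ × ℝ) := {y | a * y.1 + b * y.2 ≤ a * x.1 + b * x.2} with hH
  have hconv : Convex ℝ H := by
    intro y hy z hz s t hs ht hst
    have h1 := mul_le_mul_of_nonneg_left (Set.mem_ofPred.1 hy) hs
    have h2 := mul_le_mul_of_nonneg_left (Set.mem_ofPred.1 hz) ht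
    have : a * x.1 + b * x.2 = s * (a * x.1 + b * x.2) + t * (a * x.1 + b * x.2) := by
      rw [← add_mul, hst, one_mul]
    simp [hH]
    linarith
  have hsub : H ⊆ connectedComponentIn P.boundaryᶜ x := by
    apply hconv.isPreconnected.subset_connectedComponentIn (by simp [hH])
    intro y hy hyb
    have := hbd y hyb
    have := Set.mem_ofPred.1 hy
    linarith
  obtain ⟨R, hR⟩ := (hbdd.subset hsub).exists_norm_le
  have hray : ∀ t : ℝ, 0 ≤ t → (x.1 - t * a, x.2 - t * b) ∈ H := by
    intro t ht
    simp [hH]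
    nlinarith
  have hbound : ∀ t : ℝ, 0 ≤ t → t * (a ^ 2 + b ^ 2) ≤
      |a| * (|x.1| + R) + |b| * (|x.2| + R) := by
    intro t ht
    have h1 := hR _ (hray t ht)
    rw [Prod.norm_def, max_le_iff, Real.norm_eq_abs, Real.norm_eq_abs] at h1
    have e1 : |t * a| ≤ |x.1| + R := by
      calc |t * a| = |x.1 - (x.1 - t * a)| := by ring_nf
        _ ≤ |x.1| + |x.1 - t * a| := abs_sub _ _
        _ ≤ _ := by linarith [h1.1]
    have e2 : |t * b| ≤ |x.2| + R := by
      calc |t * b| = |x.2 - (x.2 - t * b)| := by ring_nf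
        _ ≤ |x.2| + |x.2 - t * b| := abs_sub _ _
        _ ≤ _ := by linarith [h1.2]
    have f1 := mul_le_mul_of_nonneg_left e1 (abs_nonneg a)
    have f2 := mul_le_mul_of_nonneg_left e2 (abs_nonneg b)
    rw [← abs_mul] at f1 f2
    have g1 := le_abs_self (a * (t * a))
    have g2 := le_abs_self (b * (t * b))
    nlinarith
  have hRn : 0 ≤ R := (norm_nonneg _).trans (hR _ (hray 0 le_rfl))
  have hC : 0 ≤ |a| * (|x.1| + R) + |b| * (|x.2| + R) := by positivity
  have := hbound ((|a| * (|x.1| + R) + |b| * (|x.2| + R) + 1) / (a ^ 2 + b ^ 2)) (by positivity)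
  rw [div_mul_cancel₀ _ hab.ne'] at this
  linarith

/-- The thin triangle with two vertices at distance `ε` to the right of `c`, bounding the
directions of slope between `lo` and `hi`. -/
def wedge (c : ℝ × ℝ) (ε lo hi : ℝ) (hε : 0 < ε) (h : lo < hi) : SimplePolygon :=
  SimplePolygon.ofCrossPos 3 le_rfl
    ![(c.1 + ε, c.2 + ε * lo), (c.1 + ε, c.2 + ε * hi), (c.1 + ε / 2, c.2 + ε / 2 * lo)]
    (by
      have h1 : 0 < ε * ε * (hi - lo) := by have := sub_pos.2 h; positivity
      have hall : ∀ i l : Fin 3, l ≠ i → l ≠ i + 1 → 0 < crossProd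
          (![(c.1 + ε, c.2 + ε * lo), (c.1 + ε, c.2 + ε * hi),
            (c.1 + ε / 2, c.2 + ε / 2 * lo)] i)
          (![(c.1 + ε, c.2 + ε * lo), (c.1 + ε, c.2 + ε * hi),
            (c.1 + ε / 2, c.2 + ε / 2 * lo)] (i + 1))
          (![(c.1 + ε, c.2 + ε * lo), (c.1 + ε, c.2 + ε * hi),
            (c.1 + ε / 2, c.2 + ε / 2 * lo)] l) := by
        intro i l
        fin_cases i <;> fin_cases l <;> simp [crossProd] <;> nlinarith
      exact hall)

theorem wedge_halfPlane {c : ℝ × ℝ} {ε lo hi : ℝ} (hε : 0 < ε) (h : lo < hi) {a b d : ℝ}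
    (h0 : d ≤ a * (c.1 + ε) + b * (c.2 + ε * lo)) (h1 : d ≤ a * (c.1 + ε) + b * (c.2 + ε * hi))
    (h2 : d ≤ a * (c.1 + ε / 2) + b * (c.2 + ε / 2 * lo)) {x : ℝ × ℝ}
    (hx : x ∈ (wedge c ε lo hi hε h).toSet) : d ≤ a * x.1 + b * x.2 := by
  refine SimplePolygon.halfPlane_of_mem_toSet _ (fun i => ?_) hx
  change Fin 3 at i
  fin_cases i
  · exact h0
  · exact h1
  · exact h2

theorem mem_wedge {c : ℝ × ℝ} {ε lo hi : ℝ} (hε : 0 < ε) (h : lo < hi) {x : ℝ × ℝ}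
    (hx : x ∈ (wedge c ε lo hi hε h).toSet) :
    0 < x.1 - c.1 ∧ x.1 - c.1 ≤ ε ∧ slopeOf c x ∈ Set.Icc lo hi := by
  have h1 := wedge_halfPlane hε h (a := 1) (b := 0) (d := c.1 + ε / 2) (by linarith)
    (by linarith) (by linarith) hx
  have h2 := wedge_halfPlane hε h (a := -1) (b := 0) (d := -(c.1 + ε)) (by linarith)
    (by linarith) (by linarith) hx
  have h3 := wedge_halfPlane hε h (a := -lo) (b := 1) (d := c.2 - lo * c.1) (by linarith)
    (by nlinarith) (by linarith) hx
  have h4 := wedge_halfPlane hε h (a := hi) (b := -1) (d := hi * c.1 - c.2) (by nlinarith)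
    (by linarith) (by nlinarith) hx
  have hpos : 0 < x.1 - c.1 := by linarith
  refine ⟨hpos, by linarith, ?_, ?_⟩
  · rw [slopeOf, le_div_iff₀ hpos]
    linarith
  · rw [slopeOf, div_le_iff₀ hpos]
    linarith

theorem segment_inter_wedge_nonempty {c v : ℝ × ℝ} {ε lo hi : ℝ} (hε : 0 < ε) (h : lo < hi)
    (hv : ε ≤ v.1 - c.1) (hs : slopeOf c v ∈ Set.Icc lo hi) :
    (segment ℝ c v ∩ (wedge c ε lo hi hε h).toSet).Nonempty := by
  have hd : 0 < v.1 - c.1 := by linarith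
  refine ⟨(c.1 + ε, c.2 + ε * slopeOf c v), ⟨1 - ε / (v.1 - c.1), ε / (v.1 - c.1), ?_, ?_, ?_, ?_⟩,
    Or.inl (Set.mem_iUnion.2 ⟨(0 : Fin 3), (hi - slopeOf c v) / (hi - lo),
      (slopeOf c v - lo) / (hi - lo), ?_, ?_, ?_, ?_⟩)⟩
  · rw [sub_nonneg, div_le_one hd]
    exact hv
  · positivity
  · ring
  · ext
    · simp
      field_simp
      ring
    · simp [slopeOf]
      field_simp
      ring
  · exact div_nonneg (sub_nonneg.2 hs.2) (sub_pos.2 h).le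
  · exact div_nonneg (sub_nonneg.2 hs.1) (sub_pos.2 h).le
  · rw [← add_div, div_eq_one_iff_eq (sub_pos.2 h).ne']
    ring
  · have hne := (sub_pos.2 h).ne'
    change _ • ((c.1 + ε, c.2 + ε * lo) : ℝ × ℝ) + _ • ((c.1 + ε, c.2 + ε * hi) : ℝ × ℝ) = _
    ext
    · simp
      field_simp
      ring
    · simp
      field_simp
      ring

/-- The point with abscissa `m + 1/2` on the parabola `y = x² + K + 1/4`. -/
def parabolaPt (K : ℝ) (m : ℕ) : ℝ × ℝ := (m + 1 / 2, (m + 1 / 2) ^ 2 + K + 1 / 4)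

theorem crossProd_parabolaPt (K : ℝ) (a b c : ℕ) :
    crossProd (parabolaPt K a) (parabolaPt K b) (parabolaPt K c) =
      ((b : ℝ) - a) * ((c - a) * (c - b)) := by
  simp only [crossProd, parabolaPt]
  ring

/-- The convex polygon with vertices `parabolaPt K m` for `m ≤ N`. -/
def parabolaPolygon (K : ℝ) (N : ℕ) (hN : 2 ≤ N) : SimplePolygon :=
  SimplePolygon.ofCrossPos (N + 1) (by omega) (fun i => parabolaPt K i.val) (by
    intro i l hli hli1
    have hi := ZMod.val_lt i
    have hl := ZMod.val_lt l
    have hli' : l.val ≠ i.val := fun h => hli (ZMod.val_injective _ h)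
    have hli1' : l.val ≠ (i + 1).val := fun h => hli1 (ZMod.val_injective _ h)
    have hone : (1 : ZMod (N + 1)).val = 1 := ZMod.val_one'' (by omega)
    rw [crossProd_parabolaPt]
    rcases Nat.lt_or_ge (i.val + 1) (N + 1) with hlt | hge
    · have hs : (i + 1).val = i.val + 1 := by
        rw [ZMod.val_add_of_lt (by rw [hone]; exact hlt), hone]
      rw [hs] at hli1' ⊢
      push_cast
      rcases Nat.lt_or_ge l.val i.val with h | h
      · have : (l.val : ℝ) < i.val := by exact_mod_cast h
        nlinarith
      · have : ((i.val + 1 : ℕ) : ℝ) < l.val := by exact_mod_cast (by omega)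
        push_cast at this
        nlinarith
    · have hs : (i + 1).val = 0 := by
        rw [ZMod.val_add, hone, show i.val + 1 = N + 1 by omega, Nat.mod_self]
      rw [hs] at hli1' ⊢
      have h1 : (0 : ℝ) < l.val := by exact_mod_cast (by omega)
      have h2 : (l.val : ℝ) < i.val := by exact_mod_cast (by omega)
      have := mul_pos (mul_pos (h1.trans h2) h1) (sub_pos.2 h2)
      push_cast
      nlinarith)

/-- The polygon lies above every tangent of its parabola. -/
theorem tangent_le_of_mem_parabolaPolygon {K : ℝ} {N : ℕ} {hN : 2 ≤ N} {x : ℝ × ℝ}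
    (hx : x ∈ (parabolaPolygon K N hN).toSet) (τ : ℝ) :
    K + 1 / 4 - τ ^ 2 ≤ -(2 * τ) * x.1 + 1 * x.2 := by
  refine SimplePolygon.halfPlane_of_mem_toSet _ (fun i => ?_) hx
  change _ ≤ _ * (parabolaPt K (ZMod.val (n := N + 1) i)).1 +
    _ * (parabolaPt K (ZMod.val (n := N + 1) i)).2
  simp only [parabolaPt]
  nlinarith [sq_nonneg ((ZMod.val (n := N + 1) i : ℝ) + 1 / 2 - τ)]

/-- Chords between lattice points of the parabola `y = x² + K` meet the polygon. -/
theorem chord_inter_parabolaPolygon_nonempty {K : ℝ} {N : ℕ} {hN : 2 ≤ N} {i j : ℕ}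
    (hi : 1 ≤ i) (hij : i < j) (hj : j ≤ N) :
    (segment ℝ ((i : ℝ), (i : ℝ) ^ 2 + K) ((j : ℝ), (j : ℝ) ^ 2 + K) ∩
      (parabolaPolygon K N hN).toSet).Nonempty := by
  obtain ⟨m, rfl⟩ : ∃ m, i = m + 1 := ⟨i - 1, by omega⟩
  have hd : (1 : ℝ) ≤ (j : ℝ) - (m + 1 : ℕ) := by
    have : ((m + 1 + 1 : ℕ) : ℝ) ≤ j := by exact_mod_cast hij
    push_cast at this ⊢
    linarith
  obtain ⟨s, hs⟩ : ∃ s : ℝ, s * ((j : ℝ) - (m + 1 : ℕ)) = 1 / 2 :=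
    ⟨1 / 2 / ((j : ℝ) - (m + 1 : ℕ)), by field_simp⟩
  have hs0 : 0 < s := by
    by_contra! h
    nlinarith
  have hs1 : s ≤ 1 / 2 := by nlinarith
  refine ⟨((m + 1 : ℕ) + s, ((m + 1 : ℕ) : ℝ) ^ 2 + ((m + 1 : ℕ) + j) * s + K),
    ⟨1 - 2 * s ^ 2, 2 * s ^ 2, ?_, ?_, ?_, ?_⟩,
    Or.inl (Set.mem_iUnion.2 ⟨((m : ℕ) : ZMod (N + 1)), 1 / 2 - s, 1 / 2 + s, ?_, ?_, ?_, ?_⟩)⟩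
  · nlinarith
  · positivity
  · ring
  · ext
    · simp only [Prod.fst_add, Prod.smul_fst, smul_eq_mul]
      linear_combination 2 * s * hs
    · simp only [Prod.snd_add, Prod.smul_snd, smul_eq_mul]
      linear_combination (2 * s * ((m + 1 : ℕ) + (j : ℝ))) * hs
  · linarith
  · linarith
  · ring
  · have e1 : ((m : ℕ) : ZMod (N + 1)).val = m := ZMod.val_cast_of_lt (by omega)
    have e2 : ((m : ℕ) + 1 : ZMod (N + 1)).val = m + 1 := by
      have := ZMod.val_cast_of_lt (n := N + 1) (a := m + 1) (by omega)
      simpa using this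
    change _ • parabolaPt K (((m : ℕ) : ZMod (N + 1)).val) +
      _ • parabolaPt K (((m : ℕ) + 1 : ZMod (N + 1)).val) = _
    rw [e1, e2]
    ext
    · simp [parabolaPt]
      ring
    · simp only [parabolaPt, Prod.snd_add, Prod.smul_snd, smul_eq_mul]
      push_cast at hs ⊢
      linear_combination -hs

open Filter Topology in
/-- Points off finitely many segments have a common radius of clearance. -/
theorem exists_clearance {V : Type*} [Fintype V] (pos : V → ℝ × ℝ)
    (hinj : Function.Injective pos)
    (hgen : ∀ u v w : V, u ≠ v → u ≠ w → v ≠ w →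
      ¬ Collinear ℝ ({pos u, pos v, pos w} : Set (ℝ × ℝ))) (L : ℝ) :
    ∃ r > 0, (∀ x u v : V, x ≠ u → x ≠ v →
        Disjoint (Metric.closedBall (pos x) r) (segment ℝ (pos u) (pos v))) ∧
      (∀ x y : V, x ≠ y →
        Disjoint (Metric.closedBall (pos x) r) (Metric.closedBall (pos y) r)) ∧
      (∀ x y : V, (pos x).1 < (pos y).1 → r ≤ (pos y).1 - (pos x).1) ∧
      (∀ x : V, (pos x).2 < L → (pos x).2 + r < L) := by
  have hsmall : ∀ a : ℝ, 0 < a → ∀ᶠ r in 𝓝[>] (0 : ℝ), r < a := fun a ha =>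
    nhdsWithin_le_nhds (gt_mem_nhds ha)
  have h1 : ∀ᶠ r in 𝓝[>] (0 : ℝ), ∀ x u v : V, x ≠ u → x ≠ v →
      Disjoint (Metric.closedBall (pos x) r) (segment ℝ (pos u) (pos v)) := by
    simp only [eventually_all]
    intro x u v hxu hxv
    have hnot : pos x ∉ segment ℝ (pos u) (pos v) := by
      intro hx
      by_cases huv : u = v
      · subst huv
        rw [segment_same] at hx
        exact hxu (hinj hx)
      · refine hgen u x v hxu.symm huv hxv (Wbtw.collinear ?_)
        rwa [← mem_segment_iff_wbtw]
    have hcl : IsClosed (segment ℝ (pos u) (pos v)) := by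
      rw [segment_eq_image]
      exact (isCompact_Icc.image (by fun_prop)).isClosed
    obtain ⟨ε, hε, hball⟩ := Metric.mem_nhds_iff.1 (hcl.isOpen_compl.mem_nhds hnot)
    filter_upwards [hsmall ε hε] with r hr
    exact Set.disjoint_left.2 fun z hz => hball (Metric.closedBall_subset_ball hr hz)
  have h2 : ∀ᶠ r in 𝓝[>] (0 : ℝ), ∀ x y : V, x ≠ y →
      Disjoint (Metric.closedBall (pos x) r) (Metric.closedBall (pos y) r) := by
    simp only [eventually_all]
    intro x y hxy
    have hd : 0 < dist (pos x) (pos y) := dist_pos.2 (hinj.ne hxy)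
    filter_upwards [hsmall _ (half_pos hd)] with r hr
    exact Metric.closedBall_disjoint_closedBall (by linarith)
  have h3 : ∀ᶠ r in 𝓝[>] (0 : ℝ), ∀ x y : V, (pos x).1 < (pos y).1 →
      r ≤ (pos y).1 - (pos x).1 := by
    simp only [eventually_all]
    intro x y hxy
    filter_upwards [hsmall _ (sub_pos.2 hxy)] with r hr using hr.le
  have h4 : ∀ᶠ r in 𝓝[>] (0 : ℝ), ∀ x : V, (pos x).2 < L → (pos x).2 + r < L := by
    simp only [eventually_all]
    intro x hx
    filter_upwards [hsmall _ (sub_pos.2 hx)] with r hr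
    linarith
  obtain ⟨r, hr, hr0⟩ := ((h1.and (h2.and (h3.and h4))).and self_mem_nhdsWithin).exists
  exact ⟨r, hr0, hr⟩

theorem slopeOf_eq_of_mem_segment {c v z : ℝ × ℝ} (hz : z ∈ segment ℝ c v)
    (hpos : 0 < z.1 - c.1) : c.1 < v.1 ∧ slopeOf c v = slopeOf c z := by
  obtain ⟨s, t, hs, ht, hst, rfl⟩ := hz
  obtain rfl : s = 1 - t := by linarith
  simp only [Prod.fst_add, Prod.smul_fst, smul_eq_mul] at hpos
  have h1 : 0 < t * (v.1 - c.1) := by linarith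
  have ht0 : 0 < t := lt_of_le_of_ne ht (by rintro rfl; simp at h1)
  have h2 : 0 < v.1 - c.1 := (pos_iff_pos_of_mul_pos h1).1 ht0
  refine ⟨by linarith, ?_⟩
  simp only [slopeOf, Prod.fst_add, Prod.snd_add, Prod.smul_fst, Prod.smul_snd, smul_eq_mul]
  rw [show (1 - t) * c.2 + t * v.2 - c.2 = t * (v.2 - c.2) by ring,
    show (1 - t) * c.1 + t * v.1 - c.1 = t * (v.1 - c.1) by ring,
    mul_div_mul_left _ _ ht0.ne']

theorem wedge_subset_closedBall {c : ℝ × ℝ} {r lo hi : ℝ}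
    (hε : 0 < r / (1 + |lo| + |hi|)) (h : lo < hi) :
    (wedge c (r / (1 + |lo| + |hi|)) lo hi hε h).toSet ⊆ Metric.closedBall c r := by
  intro x hx
  obtain ⟨h1, h2, h3⟩ := mem_wedge hε h hx
  set B := 1 + |lo| + |hi| with hB
  have hB1 : 1 ≤ B := by linarith [abs_nonneg lo, abs_nonneg hi]
  rw [le_div_iff₀ (by linarith)] at h2
  have hs : |slopeOf c x| ≤ B := by
    rw [abs_le]
    constructor <;>
    linarith [h3.1, h3.2, neg_abs_le lo, le_abs_self hi, abs_nonneg lo, abs_nonneg hi]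
  have he : x.2 - c.2 = slopeOf c x * (x.1 - c.1) := by
    rw [slopeOf, div_mul_cancel₀ _ h1.ne']
  rw [Metric.mem_closedBall, Prod.dist_eq, max_le_iff, Real.dist_eq, Real.dist_eq, he, abs_mul,
    abs_of_pos h1]
  constructor <;> nlinarith

/-- A vertex placement, one obstacle lying above the line `y = L`, and a family of slope
intervals at vertices below that line together yield an obstacle representation, the intervals
being realised by wedges close to their vertices. -/
theorem exists_obstacleRep_of_wedges {V ι : Type*} [Fintype V] [Fintype ι] (G : SimpleGraph V)
    (pos : V → ℝ × ℝ) (hinj : Function.Injective pos)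
    (hgen : ∀ u v w : V, u ≠ v → u ≠ w → v ≠ w →
      ¬ Collinear ℝ ({pos u, pos v, pos w} : Set (ℝ × ℝ)))
    (P : SimplePolygon) (L : ℝ) (hPL : ∀ x ∈ P.toSet, L ≤ x.2)
    (hPclear : ∀ u v, G.Adj u v → Disjoint (segment ℝ (pos u) (pos v)) P.toSet)
    (c : ι → V) (lo hi : ι → ℝ) (hlohi : ∀ i, lo i < hi i) (hcL : ∀ i, (pos (c i)).2 < L)
    (hdisj : ∀ i j, i ≠ j → c i = c j → Disjoint (Set.Icc (lo i) (hi i)) (Set.Icc (lo j) (hi j)))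
    (hclear : ∀ i v, G.Adj (c i) v → slopeOf (pos (c i)) (pos v) ∉ Set.Icc (lo i) (hi i))
    (hblocked : ∀ u v, u ≠ v → ¬ G.Adj u v →
      (segment ℝ (pos u) (pos v) ∩ P.toSet).Nonempty ∨
      ∃ i, ∃ w, ((c i = u ∧ w = v) ∨ (c i = v ∧ w = u)) ∧ (pos (c i)).1 < (pos w).1 ∧
        slopeOf (pos (c i)) (pos w) ∈ Set.Icc (lo i) (hi i)) :
    ∃ R : ObstacleRep G, R.numObs = Fintype.card ι + 1 := by
  obtain ⟨r, hr, hseg, hball, hgap, hlow⟩ := exists_clearance pos hinj hgen L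
  have hε : ∀ i, 0 < r / (1 + |lo i| + |hi i|) := fun i => by positivity
  let W : ι → SimplePolygon := fun i => wedge (pos (c i)) _ (lo i) (hi i) (hε i) (hlohi i)
  have hWball : ∀ i, (W i).toSet ⊆ Metric.closedBall (pos (c i)) r := fun i =>
    wedge_subset_closedBall (hε i) (hlohi i)
  have hWP : ∀ i, Disjoint (W i).toSet P.toSet := by
    intro i
    rw [Set.disjoint_left]
    intro x hx hxP
    have h1 := hWball i hx
    rw [Metric.mem_closedBall, Prod.dist_eq, max_le_iff, Real.dist_eq, Real.dist_eq] at h1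
    linarith [hPL x hxP, hlow _ (hcL i), le_abs_self (x.2 - (pos (c i)).2)]
  have hWW : ∀ i j, i ≠ j → Disjoint (W i).toSet (W j).toSet := by
    intro i j hij
    by_cases hc : c i = c j
    · rw [Set.disjoint_left]
      intro x hx hx'
      have h1 := (mem_wedge _ _ hx).2.2
      have h2 := (mem_wedge _ _ hx').2.2
      rw [← hc] at h2
      exact Set.disjoint_left.1 (hdisj i j hij hc) h1 h2
    · exact (hball _ _ hc).mono (hWball i) (hWball j)
  have hWedge : ∀ i v, G.Adj (c i) v → Disjoint (segment ℝ (pos (c i)) (pos v)) (W i).toSet := by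
    intro i v hv
    rw [Set.disjoint_left]
    intro x hx hx'
    obtain ⟨h1, -, h2⟩ := mem_wedge _ _ hx'
    rw [← (slopeOf_eq_of_mem_segment hx h1).2] at h2
    exact hclear i v hv h2
  let O : Option ι → SimplePolygon := fun o => o.elim P W
  have hO : ∀ o o', o ≠ o' → Disjoint (O o).toSet (O o').toSet := by
    rintro (_ | i) (_ | j) h
    · exact absurd rfl h
    · exact (hWP j).symm
    · exact hWP i
    · exact hWW i j (by simpa using h)
  have hOclear : ∀ u v, G.Adj u v → ∀ o, Disjoint (segment ℝ (pos u) (pos v)) (O o).toSet := by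
    rintro u v huv (_ | i)
    · exact hPclear u v huv
    · change Disjoint _ (W i).toSet
      by_cases hu : c i = u
      · subst hu
        exact hWedge i v huv
      by_cases hv : c i = v
      · subst hv
        rw [segment_symm]
        exact hWedge i u huv.symm
      exact ((hseg _ _ _ hu hv).mono_left (hWball i)).symm
  have hOblocked : ∀ u v, u ≠ v → ¬ G.Adj u v →
      ∃ o, (segment ℝ (pos u) (pos v) ∩ (O o).toSet).Nonempty := by
    intro u v huv hadj
    rcases hblocked u v huv hadj with h | ⟨i, w, hw, hlt, hs⟩
    · exact ⟨none, h⟩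
    · refine ⟨some i, ?_⟩
      have hle : r / (1 + |lo i| + |hi i|) ≤ r :=
        div_le_self hr.le (by linarith [abs_nonneg (lo i), abs_nonneg (hi i)])
      have := segment_inter_wedge_nonempty (hε i) (hlohi i) (hle.trans (hgap _ _ hlt)) hs
      rcases hw with ⟨rfl, rfl⟩ | ⟨rfl, rfl⟩
      · exact this
      · rw [segment_symm]
        exact this
  let e := Fintype.equivFin (Option ι)
  refine ⟨⟨pos, hinj, hgen, Fintype.card (Option ι), fun n => O (e.symm n), ?_, ?_, ?_⟩, ?_⟩
  · exact fun i j hij => hO _ _ (e.symm.injective.ne hij)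
  · exact fun u v huv n => hOclear u v huv _
  · intro u v huv hadj
    obtain ⟨o, ho⟩ := hOblocked u v huv hadj
    exact ⟨e o, by simpa using ho⟩
  · exact Fintype.card_option

theorem segment_disjoint_parabolaPolygon {K : ℝ} {N : ℕ} {hN : 2 ≤ N} {p q : ℝ × ℝ} (τ : ℝ)
    (hp : -(2 * τ) * p.1 + p.2 < K + 1 / 4 - τ ^ 2)
    (hq : -(2 * τ) * q.1 + q.2 < K + 1 / 4 - τ ^ 2) :
    Disjoint (segment ℝ p q) (parabolaPolygon K N hN).toSet := by
  rw [Set.disjoint_left]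
  rintro x ⟨s, t, hs, ht, hst, rfl⟩ hx
  have h := tangent_le_of_mem_parabolaPolygon hx τ
  obtain rfl : s = 1 - t := by linarith
  simp at h
  rcases ht.eq_or_lt with rfl | ht'
  · linarith
  · nlinarith [mul_lt_mul_of_pos_left hq ht', mul_le_mul_of_nonneg_left hp.le hs]

theorem slopeOf_lower_lower {a b : ℝ} (h : a ≠ b) :
    slopeOf (-a, a ^ 2) (-b, b ^ 2) = -(a + b) := by
  have h' : -b - -a ≠ 0 := fun hh => h (by linarith)
  rw [slopeOf, div_eq_iff h']
  ring

theorem slopeOf_lower_upper_pos {K a τ : ℝ} (ha : 0 ≤ a) (hτ : 0 < τ) (hK : a ^ 2 < K) :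
    0 < slopeOf (-a, a ^ 2) (τ, τ ^ 2 + K) :=
  div_pos (by simp only; nlinarith) (by simp only; linarith)

theorem slopeOf_lower_upper_lt {K a τ τ' : ℝ} (ha : 0 ≤ a) (hτ : 0 < τ) (h : τ < τ')
    (hK : (τ' + a) ^ 2 < K) :
    slopeOf (-a, a ^ 2) (τ', τ' ^ 2 + K) < slopeOf (-a, a ^ 2) (τ, τ ^ 2 + K) := by
  simp only [slopeOf]
  rw [div_lt_div_iff₀ (by linarith) (by linarith)]
  have h1 : (τ + a) * (τ' + a) < K := by nlinarith
  nlinarith [mul_pos (sub_pos.2 h) (sub_pos.2 h1)]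

theorem slopeOf_lower_upper_le_iff {K a τ τ' : ℝ} (ha : 0 ≤ a) (hτ : 0 < τ) (hτ' : 0 < τ')
    (hK : (τ + a) ^ 2 < K) (hK' : (τ' + a) ^ 2 < K) :
    slopeOf (-a, a ^ 2) (τ, τ ^ 2 + K) ≤ slopeOf (-a, a ^ 2) (τ', τ' ^ 2 + K) ↔ τ' ≤ τ := by
  rcases lt_trichotomy τ τ' with h | rfl | h
  · have := slopeOf_lower_upper_lt ha hτ h hK'
    exact ⟨fun h' => absurd h' this.not_ge, fun h' => absurd h' h.not_ge⟩
  · simp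
  · exact ⟨fun _ => h.le, fun _ => (slopeOf_lower_upper_lt ha hτ' h hK).le⟩

/-- The points `(-a, a²)` with `a ∈ [0, A]` and `(b, b² + K)` with `b ∈ (0, B]`. -/
def twoParabolas (K A B : ℝ) : Set (ℝ × ℝ) :=
  {p | (∃ a, 0 ≤ a ∧ a ≤ A ∧ p = (-a, a ^ 2)) ∨ ∃ b, 0 < b ∧ b ≤ B ∧ p = (b, b ^ 2 + K)}

theorem not_collinear_of_mem_twoParabolas {K A B : ℝ} (hK : (A + B) ^ 2 < K) {p q r : ℝ × ℝ}
    (hp : p ∈ twoParabolas K A B) (hq : q ∈ twoParabolas K A B) (hr : r ∈ twoParabolas K A B)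
    (hpq : p ≠ q) (hpr : p ≠ r) (hqr : q ≠ r) :
    ¬ Collinear ℝ ({p, q, r} : Set (ℝ × ℝ)) := by
  intro hcol
  have h0 := crossProd_eq_zero_of_collinear hcol
  have hllu : ∀ {a a' b : ℝ}, 0 ≤ a → 0 ≤ a' → 0 < b → a ≤ A → b ≤ B →
      (a' - a) * ((b + a) * (b + a') + K) = 0 → a = a' := by
    intro a a' b ha ha' hb haA hbB h
    rcases mul_eq_zero.1 h with h | h
    · linarith
    · nlinarith [mul_pos (show 0 < b + a by linarith) (show 0 < b + a' by linarith)]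
  have hluu : ∀ {a b b' : ℝ}, 0 ≤ a → 0 < b → 0 < b' → a ≤ A → b ≤ B → b' ≤ B →
      (b' - b) * (K - (b + a) * (b' + a)) = 0 → b = b' := by
    intro a b b' ha hb hb' haA hbB hbB' h
    rcases mul_eq_zero.1 h with h | h
    · linarith
    · have : (b + a) * (b' + a) ≤ (A + B) * (A + B) :=
        mul_le_mul (by linarith) (by linarith) (by linarith) (by linarith)
      nlinarith
  have hsame : ∀ {a b c : ℝ}, (b - a) * ((c - a) * (c - b)) = 0 → a = b ∨ a = c ∨ b = c := by
    intro a b c h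
    rcases mul_eq_zero.1 h with h | h
    · left; linarith
    · rcases mul_eq_zero.1 h with h | h
      · right; left; linarith
      · right; right; linarith
  rcases hp with ⟨a, ha, haA, rfl⟩ | ⟨a, ha, haB, rfl⟩ <;>
  rcases hq with ⟨b, hb, hbA, rfl⟩ | ⟨b, hb, hbB, rfl⟩ <;>
  rcases hr with ⟨c, hc, hcA, rfl⟩ | ⟨c, hc, hcB, rfl⟩ <;>
  simp only [crossProd] at h0
  · rcases hsame (a := a) (b := b) (c := c) (by linear_combination -h0) with rfl | rfl | rfl
    exacts [hpq rfl, hpr rfl, hqr rfl]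
  · obtain rfl := hllu ha hb hc haA hcB (by linear_combination -h0)
    exact hpq rfl
  · obtain rfl := hllu ha hc hb haA hbB (by linear_combination h0)
    exact hpr rfl
  · obtain rfl := hluu ha hb hc haA hbB hcB (by linear_combination -h0)
    exact hqr rfl
  · obtain rfl := hllu hb hc ha hbA haB (by linear_combination -h0)
    exact hqr rfl
  · obtain rfl := hluu hb ha hc hbA haB hcB (by linear_combination h0)
    exact hpr rfl
  · obtain rfl := hluu hc ha hb hcA haB hbB (by linear_combination -h0)
    exact hpq rfl
  · rcases hsame (a := a) (b := b) (c := c) (by linear_combination h0) with rfl | rfl | rfl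
    exacts [hpq rfl, hpr rfl, hqr rfl]

theorem card_sigma_fin (k : ℕ) : Fintype.card (Σ j : Fin k, Fin j) = k * (k - 1) / 2 := by
  rw [Fintype.card_sigma]
  simp only [Fintype.card_fin]
  rw [Fin.sum_univ_eq_sum_range (fun i => i), Finset.sum_range_id]

/-- The elements of `V` can be numbered so that the fibre of `t` over `c` is numbered from the
`c`-th block of `card V` consecutive positive integers. -/
theorem exists_block_numbering {V : Type*} [Fintype V] (t : V → ℕ) :
    ∃ T : V → ℕ, Function.Injective T ∧
      ∀ v c, (c * Fintype.card V + 1 ≤ T v ∧ T v ≤ c * Fintype.card V + Fintype.card V) ↔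
        t v = c := by
  let idx := Fintype.equivFin V
  refine ⟨fun v => t v * Fintype.card V + idx v + 1, ?_, ?_⟩
  · intro u v huv
    have h := congrArg (· % Fintype.card V) (Nat.succ_injective huv)
    simp only [Nat.mul_add_mod_self_right, Nat.mod_eq_of_lt (idx _).isLt] at h
    exact idx.injective (Fin.ext h)
  · intro v c
    have hi := (idx v).isLt
    constructor
    · rintro ⟨h1, h2⟩
      rcases lt_trichotomy (t v) c with h | h | h
      · nlinarith
      · exact h
      · nlinarith
    · rintro rfl
      dsimp only
      constructor <;> omega

/-- A finite graph with a vertex cover of size `k` admits an obstacle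
representation with at most `1 + k(k-1)/2 + k·2^k` obstacles. -/
theorem obstacle_number_le_of_vertexCover {V : Type*} [Fintype V] (G : SimpleGraph V)
    (k : ℕ) (X : Finset V) (hcover : ∀ u v : V, G.Adj u v → u ∈ X ∨ v ∈ X)
    (hcard : X.card = k) :
    ∃ R : ObstacleRep G, R.numObs ≤ 1 + k * (k - 1) / 2 + k * 2 ^ k := by
  let e : X ≃ Fin k := Fintype.equivFinOfCardEq (by simpa using hcard)
  let xs : Fin k → V := fun j => (e.symm j).1
  have hxsX : ∀ j, xs j ∈ X := fun j => (e.symm j).2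
  have hxsinj : Function.Injective xs := fun i j h => e.symm.injective (Subtype.ext h)
  have hcases : ∀ v, (∃ j, v = xs j) ∨ v ∉ X := by
    intro v
    by_cases hv : v ∈ X
    · exact Or.inl ⟨e ⟨v, hv⟩, by simp [xs]⟩
    · exact Or.inr hv
  let nb : V → Finset (Fin k) := fun v => Finset.univ.filter fun j => G.Adj (xs j) v
  let code : Finset (Fin k) ≃ Fin (2 ^ k) := Fintype.equivFinOfCardEq (by simp)
  obtain ⟨T, hTinj, hT⟩ := exists_block_numbering fun v => (code (nb v) : ℕ)
  set n := Fintype.card V with hn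
  obtain ⟨N, hN⟩ : ∃ N, N = 2 ^ k * n + 2 := ⟨_, rfl⟩
  have hN2 : 2 ≤ N := by omega
  have hblock : ∀ c : Fin (2 ^ k), (c : ℕ) * n + n + 2 ≤ N := by
    intro c
    have : ((c : ℕ) + 1) * n ≤ 2 ^ k * n := Nat.mul_le_mul_right n c.isLt
    rw [hN]
    linarith
  have hT1 : ∀ v, 1 ≤ T v := fun v => by have := ((hT v _).2 rfl).1; omega
  have hTN : ∀ v, T v ≤ N := fun v => by
    have := ((hT v _).2 rfl).2
    have := hblock (code (nb v))
    omega
  obtain ⟨K, hK⟩ : ∃ K : ℝ, K = ((N : ℝ) + k + 2) ^ 2 := ⟨_, rfl⟩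
  have hjk : ∀ j : Fin k, ((j : ℕ) : ℝ) ≤ k := fun j => by exact_mod_cast j.isLt.le
  have hj0 : ∀ j : Fin k, (0 : ℝ) ≤ (j : ℕ) := fun j => Nat.cast_nonneg _
  have hN0 : (0 : ℝ) ≤ N := Nat.cast_nonneg _
  have hTpos : ∀ v, (0 : ℝ) < T v := fun v => by exact_mod_cast hT1 v
  have hTNr : ∀ v, (T v : ℝ) ≤ N := fun v => by exact_mod_cast hTN v
  have hKlt : ∀ (j : Fin k) (τ : ℝ), 0 ≤ τ → τ ≤ N → (τ + (j : ℕ)) ^ 2 < K := by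
    intro j τ h0 h1
    rw [hK]
    have := hjk j
    have := hj0 j
    exact pow_lt_pow_left₀ (by linarith) (by linarith) two_ne_zero
  have hKj : ∀ j : Fin k, ((j : ℕ) : ℝ) ^ 2 < K := fun j => by simpa using hKlt j 0 le_rfl hN0
  let pos : V → ℝ × ℝ := fun v =>
    if h : v ∈ X then (-((e ⟨v, h⟩ : ℕ) : ℝ), ((e ⟨v, h⟩ : ℕ) : ℝ) ^ 2)
    else ((T v : ℝ), (T v : ℝ) ^ 2 + K)
  have hposX : ∀ j, pos (xs j) = (-((j : ℕ) : ℝ), ((j : ℕ) : ℝ) ^ 2) := by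
    intro j
    simp [pos, xs]
  have hposY : ∀ v, v ∉ X → pos v = ((T v : ℝ), (T v : ℝ) ^ 2 + K) := by
    intro v hv
    simp [pos, hv]
  have hmem : ∀ v, pos v ∈ twoParabolas K k N := by
    intro v
    rcases hcases v with ⟨j, rfl⟩ | hv
    · exact Or.inl ⟨_, hj0 j, hjk j, hposX j⟩
    · exact Or.inr ⟨_, hTpos v, hTNr v, hposY v hv⟩
  have hinj : Function.Injective pos := by
    intro u v huv
    have h1 := congrArg Prod.fst huv
    rcases hcases u with ⟨i, rfl⟩ | hu <;> rcases hcases v with ⟨j, rfl⟩ | hv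
    · rw [hposX, hposX] at h1
      exact congrArg xs (Fin.ext (by exact_mod_cast neg_injective h1))
    · rw [hposX, hposY v hv] at h1
      simp only at h1
      linarith [hj0 i, hTpos v]
    · rw [hposX, hposY u hu] at h1
      simp only at h1
      linarith [hj0 j, hTpos u]
    · rw [hposY u hu, hposY v hv] at h1
      simp only at h1
      exact hTinj (by exact_mod_cast h1)
  let sub : (Σ j : Fin k, Fin j) → Fin k := fun p => ⟨p.2, p.2.isLt.trans p.1.isLt⟩
  let ι := {p : Fin k × Finset (Fin k) // p.1 ∉ p.2} ⊕
    {p : Σ j : Fin k, Fin j // ¬ G.Adj (xs p.1) (xs (sub p))}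
  let σ : Fin k → ℝ → ℝ := fun j τ =>
    slopeOf (-((j : ℕ) : ℝ), ((j : ℕ) : ℝ) ^ 2) (τ, τ ^ 2 + K)
  let c : ι → V := Sum.elim (fun p => xs p.1.1) (fun p => xs p.1.1)
  let lo : ι → ℝ := Sum.elim
    (fun p => σ p.1.1 ((code p.1.2 : ℕ) * n + n + 1 / 4))
    (fun p => -((p.1.1 : ℕ) + (sub p.1 : ℕ) : ℝ) - 1 / 4)
  let hi : ι → ℝ := Sum.elim
    (fun p => σ p.1.1 ((code p.1.2 : ℕ) * n + 3 / 4))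
    (fun p => -((p.1.1 : ℕ) + (sub p.1 : ℕ) : ℝ) + 1 / 4)
  have hσpos : ∀ j τ, 0 < τ → 0 < σ j τ := fun j τ hτ =>
    slopeOf_lower_upper_pos (hj0 j) hτ (hKj j)
  have hσle : ∀ (j : Fin k) (τ τ' : ℝ), 0 < τ → 0 < τ' → τ ≤ N → τ' ≤ N → (σ j τ ≤ σ j τ' ↔ τ' ≤ τ) :=
    fun j τ τ' h h' hN hN' =>
      slopeOf_lower_upper_le_iff (hj0 j) h h' (hKlt j τ h.le hN) (hKlt j τ' h'.le hN')
  have hσlt : ∀ (j : Fin k) (τ τ' : ℝ), 0 < τ → τ < τ' → τ' ≤ N → σ j τ' < σ j τ :=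
    fun j τ τ' h h' hN => slopeOf_lower_upper_lt (hj0 j) h h' (hKlt j τ' (h.trans h').le hN)
  have hn1 : Fin k → 1 ≤ n := fun j => Fintype.card_pos_iff.2 ⟨xs j⟩
  have hcn : ∀ c : Fin (2 ^ k), (0 : ℝ) ≤ (c : ℕ) * n := fun c => by positivity
  have hnr : Fin k → (1 : ℝ) ≤ n := fun j => by exact_mod_cast hn1 j
  have hcN : ∀ c : Fin (2 ^ k), ((c : ℕ) : ℝ) * n + n + 2 ≤ N := fun c => by
    exact_mod_cast hblock c
  have hslopeX : ∀ i j : Fin k, i ≠ j →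
      slopeOf (pos (xs i)) (pos (xs j)) = -((i : ℕ) + (j : ℕ) : ℝ) := by
    intro i j hij
    rw [hposX, hposX, slopeOf_lower_lower]
    exact_mod_cast fun h => hij (Fin.ext h)
  have hslopeY : ∀ (j : Fin k) (v : V), v ∉ X → slopeOf (pos (xs j)) (pos v) = σ j (T v) := by
    intro j v hv
    rw [hposX, hposY v hv]
  have hsame : ∀ p : {p : Fin k × Finset (Fin k) // p.1 ∉ p.2}, ∀ v,
      σ p.1.1 (T v) ∈ Set.Icc (lo (Sum.inl p)) (hi (Sum.inl p)) ↔ nb v = p.1.2 := by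
    intro p v
    have h1 := hcn (code p.1.2)
    have h2 := hcN (code p.1.2)
    have h3 := hnr p.1.1
    rw [Set.mem_Icc]
    change σ p.1.1 ((code p.1.2 : ℕ) * n + n + 1 / 4) ≤ _ ∧
      _ ≤ σ p.1.1 ((code p.1.2 : ℕ) * n + 3 / 4) ↔ _
    rw [hσle _ _ _ (by linarith) (hTpos v) (by linarith) (hTNr v),
      hσle _ _ _ (hTpos v) (by linarith) (hTNr v) (by linarith),
      ← code.injective.eq_iff, Fin.ext_iff, ← hT]
    constructor
    · rintro ⟨h4, h5⟩
      constructor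
      · by_contra! h
        have : (T v : ℝ) ≤ ((code p.1.2 : ℕ) : ℝ) * n := by
          exact_mod_cast Nat.lt_succ_iff.1 h
        linarith
      · by_contra! h
        have : ((code p.1.2 : ℕ) : ℝ) * n + n + 1 ≤ T v := by exact_mod_cast h
        linarith
    · rintro ⟨h4, h5⟩
      have h4' : ((code p.1.2 : ℕ) : ℝ) * n + 1 ≤ T v := by exact_mod_cast h4
      have h5' : (T v : ℝ) ≤ ((code p.1.2 : ℕ) : ℝ) * n + n := by exact_mod_cast h5
      constructor <;> linarith
  have hloinl : ∀ p, 0 < lo (Sum.inl p) := by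
    intro p
    have := hcn (code p.1.2)
    exact hσpos _ _ (by linarith [hnr p.1.1])
  have hhiinr : ∀ p, hi (Sum.inr p) < 0 := by
    intro p
    have h1 : ((sub p.1 : ℕ) : ℝ) + 1 ≤ (p.1.1 : ℕ) := by exact_mod_cast p.1.2.isLt
    change -((p.1.1 : ℕ) + (sub p.1 : ℕ) : ℝ) + 1 / 4 < 0
    linarith [hj0 (sub p.1)]
  have hblocksep : ∀ (j : Fin k) (a b : Fin (2 ^ k)), a < b →
      σ j ((b : ℕ) * n + 3 / 4) < σ j ((a : ℕ) * n + n + 1 / 4) := by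
    intro j a b hab
    have h : (((a : ℕ) : ℝ) + 1) * n ≤ (b : ℕ) * n :=
      mul_le_mul_of_nonneg_right (by exact_mod_cast hab) (by positivity)
    have h1 := hcn a
    have h2 := hcN b
    have h3 := hnr j
    exact hσlt _ _ _ (by linarith) (by linarith) (by linarith)
  obtain ⟨R, hR⟩ := exists_obstacleRep_of_wedges G pos hinj
    (fun u v w huv huw hvw => not_collinear_of_mem_twoParabolas
      (by rw [hK]; exact pow_lt_pow_left₀ (by linarith) (by positivity) two_ne_zero)
      (hmem u) (hmem v) (hmem w) (hinj.ne huv) (hinj.ne huw) (hinj.ne hvw))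
    (parabolaPolygon K N hN2) K
    (fun x hx => by have := tangent_le_of_mem_parabolaPolygon hx 0; simp at this; linarith)
    (by
      have key : ∀ j v, Disjoint (segment ℝ (pos (xs j)) (pos v))
          (parabolaPolygon K N hN2).toSet := by
        intro j v
        rcases hcases v with ⟨i, rfl⟩ | hv
        · apply segment_disjoint_parabolaPolygon 0
          · rw [hposX]
            simp only
            linarith [hKj j]
          · rw [hposX]
            simp only
            linarith [hKj i]
        · apply segment_disjoint_parabolaPolygon (T v)
          · rw [hposX]
            simp only
            linarith [hKlt j (T v) (hTpos v).le (hTNr v)]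
          · rw [hposY v hv]
            simp only
            linarith
      intro u v huv
      rcases hcases u with ⟨j, rfl⟩ | hu
      · exact key j v
      · rcases hcases v with ⟨j, rfl⟩ | hv
        · rw [segment_symm]
          exact key j u
        · exact absurd (hcover u v huv) (by tauto))
    c lo hi
    (by
      rintro (p | p)
      · have := hcn (code p.1.2)
        exact hσlt _ _ _ (by linarith) (by linarith [hnr p.1.1]) (by linarith [hcN (code p.1.2)])
      · change -((p.1.1 : ℕ) + (sub p.1 : ℕ) : ℝ) - 1 / 4 <
          -((p.1.1 : ℕ) + (sub p.1 : ℕ) : ℝ) + 1 / 4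
        linarith)
    (by
      rintro (p | p)
      · change (pos (xs p.1.1)).2 < K
        rw [hposX]
        exact hKj _
      · change (pos (xs p.1.1)).2 < K
        rw [hposX]
        exact hKj _)
    (by
      rintro (p | p) (q | q) hpq hc
      · obtain ⟨⟨i, S⟩, hp⟩ := p
        obtain ⟨⟨j, S'⟩, hq⟩ := q
        obtain rfl : i = j := hxsinj hc
        rw [Set.disjoint_left]
        rintro x ⟨h1, h2⟩ ⟨h3, h4⟩
        rcases lt_trichotomy (code S) (code S') with h | h | h
        · exact ((h1.trans h4).trans_lt (hblocksep i _ _ h)).false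
        · obtain rfl := code.injective h
          exact hpq rfl
        · exact ((h3.trans h2).trans_lt (hblocksep i _ _ h)).false
      · rw [Set.disjoint_left]
        rintro x ⟨h1, h2⟩ ⟨h3, h4⟩
        linarith [hloinl p, hhiinr q]
      · rw [Set.disjoint_left]
        rintro x ⟨h1, h2⟩ ⟨h3, h4⟩
        linarith [hloinl q, hhiinr p]
      · obtain ⟨⟨i, a⟩, hp⟩ := p
        obtain ⟨⟨j, b⟩, hq⟩ := q
        obtain rfl : i = j := hxsinj hc
        have hab : (a : ℕ) ≠ b := fun h => hpq (by obtain rfl := Fin.ext h; rfl)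
        rw [Set.disjoint_left]
        rintro x ⟨h1, h2⟩ ⟨h3, h4⟩
        change -((i : ℕ) + (a : ℕ) : ℝ) - 1 / 4 ≤ x at h1
        change x ≤ -((i : ℕ) + (a : ℕ) : ℝ) + 1 / 4 at h2
        change -((i : ℕ) + (b : ℕ) : ℝ) - 1 / 4 ≤ x at h3
        change x ≤ -((i : ℕ) + (b : ℕ) : ℝ) + 1 / 4 at h4
        rcases Nat.lt_or_gt_of_ne hab with h | h
        · have : ((a : ℕ) : ℝ) + 1 ≤ (b : ℕ) := by exact_mod_cast h
          linarith
        · have : ((b : ℕ) : ℝ) + 1 ≤ (a : ℕ) := by exact_mod_cast h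
          linarith)
    (by
      rintro (p | p) v hadj hs
      · change G.Adj (xs p.1.1) v at hadj
        change slopeOf (pos (xs p.1.1)) (pos v) ∈ _ at hs
        rcases hcases v with ⟨j, rfl⟩ | hv
        · rw [hslopeX _ _ (fun h => hadj.ne (congrArg xs h))] at hs
          linarith [hs.1, hloinl p, hj0 p.1.1, hj0 j]
        · rw [hslopeY _ v hv, hsame] at hs
          exact p.2 (hs ▸ by simpa [nb] using hadj)
      · change G.Adj (xs p.1.1) v at hadj
        change slopeOf (pos (xs p.1.1)) (pos v) ∈ _ at hs
        rcases hcases v with ⟨j, rfl⟩ | hv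
        · rw [hslopeX _ _ (fun h => hadj.ne (congrArg xs h))] at hs
          obtain ⟨h1, h2⟩ := hs
          change -((p.1.1 : ℕ) + (sub p.1 : ℕ) : ℝ) - 1 / 4 ≤ _ at h1
          change _ ≤ -((p.1.1 : ℕ) + (sub p.1 : ℕ) : ℝ) + 1 / 4 at h2
          have hj : j = sub p.1 := by
            rcases lt_trichotomy j (sub p.1) with h | h | h
            · have : ((j : ℕ) : ℝ) + 1 ≤ (sub p.1 : ℕ) := by exact_mod_cast h
              linarith
            · exact h
            · have : ((sub p.1 : ℕ) : ℝ) + 1 ≤ (j : ℕ) := by exact_mod_cast h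
              linarith
          exact p.2 (hj ▸ hadj)
        · rw [hslopeY _ v hv] at hs
          linarith [hs.2, hhiinr p, hσpos p.1.1 _ (hTpos v)])
    (by
      have hXX : ∀ i j : Fin k, j < i → ¬ G.Adj (xs i) (xs j) → ∃ o : ι, c o = xs i ∧
          (pos (c o)).1 < (pos (xs j)).1 ∧
          slopeOf (pos (c o)) (pos (xs j)) ∈ Set.Icc (lo o) (hi o) := by
        intro i j hij hadj
        refine ⟨Sum.inr ⟨⟨i, ⟨j, hij⟩⟩, hadj⟩, rfl, ?_, ?_⟩
        · change (pos (xs i)).1 < _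
          rw [hposX, hposX]
          have : ((j : ℕ) : ℝ) < (i : ℕ) := by exact_mod_cast hij
          simpa using this
        · change slopeOf (pos (xs i)) _ ∈
            Set.Icc (-((i : ℕ) + (j : ℕ) : ℝ) - 1 / 4) (-((i : ℕ) + (j : ℕ) : ℝ) + 1 / 4)
          rw [hslopeX i j hij.ne']
          constructor <;> linarith
      have hXY : ∀ (i : Fin k) (v : V), v ∉ X → ¬ G.Adj (xs i) v → ∃ o : ι, c o = xs i ∧
          (pos (c o)).1 < (pos v).1 ∧ slopeOf (pos (c o)) (pos v) ∈ Set.Icc (lo o) (hi o) := by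
        intro i v hv hadj
        have hnb : i ∉ nb v := by simpa [nb] using hadj
        refine ⟨Sum.inl ⟨⟨i, nb v⟩, hnb⟩, rfl, ?_, ?_⟩
        · change (pos (xs i)).1 < _
          rw [hposX, hposY v hv]
          simp only
          linarith [hj0 i, hTpos v]
        · change slopeOf (pos (xs i)) _ ∈ _
          rw [hslopeY i v hv]
          exact (hsame ⟨⟨i, nb v⟩, hnb⟩ v).2 rfl
      intro u v huv hadj
      rcases hcases u with ⟨i, rfl⟩ | hu <;> rcases hcases v with ⟨j, rfl⟩ | hv
      · right
        rcases lt_or_gt_of_ne (fun h => huv (congrArg xs h) : i ≠ j) with h | h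
        · obtain ⟨o, ho, ho'⟩ := hXX j i h (fun h => hadj h.symm)
          exact ⟨o, _, Or.inr ⟨ho, rfl⟩, ho'⟩
        · obtain ⟨o, ho, ho'⟩ := hXX i j h hadj
          exact ⟨o, _, Or.inl ⟨ho, rfl⟩, ho'⟩
      · right
        obtain ⟨o, ho, ho'⟩ := hXY i v hv hadj
        exact ⟨o, _, Or.inl ⟨ho, rfl⟩, ho'⟩
      · right
        obtain ⟨o, ho, ho'⟩ := hXY j u hu (fun h => hadj h.symm)
        exact ⟨o, _, Or.inr ⟨ho, rfl⟩, ho'⟩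
      · left
        rw [hposY u hu, hposY v hv]
        rcases Nat.lt_or_gt_of_ne (hTinj.ne huv) with h | h
        · exact chord_inter_parabolaPolygon_nonempty (hT1 u) h (hTN v)
        · rw [segment_symm]
          exact chord_inter_parabolaPolygon_nonempty (hT1 v) h (hTN u))
  refine ⟨R, ?_⟩
  have h1 : Fintype.card {p : Fin k × Finset (Fin k) // p.1 ∉ p.2} ≤ k * 2 ^ k :=
    (Fintype.card_subtype_le _).trans (by simp)
  have h2 : Fintype.card {p : Σ j : Fin k, Fin j // ¬ G.Adj (xs p.1) (xs (sub p))} ≤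
      k * (k - 1) / 2 :=
    (Fintype.card_subtype_le _).trans (card_sigma_fin k).le
  rw [hR, Fintype.card_sum]
  omega
end
end

section
/- Let O ⊆ ℝ² be a convex set and let u, v ∈ ℝ² be two distinct points. Then O intersects the closed segment [u, v] if and only if O intersects the ray {u + s·(v − u) : s ≥ 0} starting at u and passing through v, and O intersects the ray {v + t·(u − v) : t ≥ 0} starting at v and passing through u. -/
/-- A convex set `O` meets the closed segment `[u,v]` iff it meets both the ray from
`u` through `v` and the ray from `v` through `u`. -/
theorem convex_inter_segment_iff_inter_rays (O : Set (ℝ × ℝ)) (hO : Convex ℝ O)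
    (u v : ℝ × ℝ) (huv : u ≠ v) :
    (O ∩ segment ℝ u v).Nonempty ↔
      (O ∩ {p | ∃ s : ℝ, 0 ≤ s ∧ p = u + s • (v - u)}).Nonempty ∧
      (O ∩ {p | ∃ t : ℝ, 0 ≤ t ∧ p = v + t • (u - v)}).Nonempty := by
  have reverse (t : ℝ) : v + t • (u - v) = u + (1 - t) • (v - u) := by module
  rw [segment_eq_image']
  constructor
  · rintro ⟨_, hp, s, ⟨hs₀, hs₁⟩, rfl⟩
    exact ⟨⟨_, hp, s, hs₀, rfl⟩, ⟨_, hp, 1 - s, sub_nonneg.2 hs₁, by rw [reverse, sub_sub_cancel]⟩⟩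
  · rintro ⟨⟨_, hp, s, hs, rfl⟩, ⟨_, hq, t, ht, rfl⟩⟩
    rw [reverse] at hq
    -- The parameters of the points of the line `uv` lying in `O` form an interval.
    have hI : (AffineMap.lineMap (k := ℝ) u v ⁻¹' O).OrdConnected :=
      (hO.affine_preimage (AffineMap.lineMap u v)).ordConnected
    have mem (r : ℝ) : r ∈ AffineMap.lineMap (k := ℝ) u v ⁻¹' O ↔ u + r • (v - u) ∈ O := by
      rw [Set.mem_preimage, AffineMap.lineMap_apply_module', add_comm]
    rcases le_total s 1 with hs₁ | hs₁
    · exact ⟨_, hp, s, ⟨hs, hs₁⟩, rfl⟩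
    rcases le_total 0 (1 - t) with ht₀ | ht₀
    · exact ⟨_, hq, 1 - t, ⟨ht₀, sub_le_self 1 ht⟩, rfl⟩
    · exact ⟨_, (mem 0).1 (hI.out ((mem _).2 hq) ((mem _).2 hp) ⟨ht₀, hs⟩), 0,
        ⟨le_rfl, zero_le_one⟩, rfl⟩
end

section
/- Let x, s, t, u ∈ ℝ² be four points, no three of which are collinear. Then there is no connected set P ⊆ ℝ² that intersects each of the three closed segments [s, t], [t, u], [u, s] and is disjoint from each of the three rays {x + r·(w − x) : r ≥ 0} for w ∈ {s, t, u}. -/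
/-- The signed area of the parallelogram spanned by `a - x` and `b - x`. -/
def areaForm (x a b : ℝ × ℝ) : ℝ :=
  (a.1 - x.1) * (b.2 - x.2) - (a.2 - x.2) * (b.1 - x.1)

lemma areaForm_swap (x a b : ℝ × ℝ) : areaForm x b a = -areaForm x a b := by
  unfold areaForm; ring

lemma collinear_of_areaForm_eq_zero {x a b : ℝ × ℝ} (h : areaForm x a b = 0) :
    Collinear ℝ ({x, a, b} : Set (ℝ × ℝ)) := by
  rcases eq_or_ne a x with rfl | hne
  · simpa using collinear_pair ℝ a b
  have hpos : (a.1 - x.1) ^ 2 + (a.2 - x.2) ^ 2 ≠ 0 := by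
    intro h0
    apply hne
    ext <;> nlinarith [sq_nonneg (a.1 - x.1), sq_nonneg (a.2 - x.2)]
  rw [collinear_iff_of_mem (p₀ := x) (by simp)]
  refine ⟨a - x, ?_⟩
  rintro p (rfl | rfl | rfl)
  · exact ⟨0, by simp⟩
  · exact ⟨1, by simp⟩
  · refine ⟨((p.1 - x.1) * (a.1 - x.1) + (p.2 - x.2) * (a.2 - x.2)) /
      ((a.1 - x.1) ^ 2 + (a.2 - x.2) ^ 2), ?_⟩
    unfold areaForm at h
    ext
    · simp only [vadd_eq_add, Prod.fst_add, Prod.smul_fst, Prod.fst_sub, smul_eq_mul]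
      field_simp
      linear_combination (-(a.2 - x.2)) * h
    · simp only [vadd_eq_add, Prod.snd_add, Prod.smul_snd, Prod.snd_sub, smul_eq_mul]
      field_simp
      linear_combination (a.1 - x.1) * h

/-- A point on the line through `x` and `b`, on the same side of the line through `x` and `a`
as `b`, lies on the ray from `x` through `b`. -/
lemma exists_ray_of_areaForm_eq_zero {x a b p : ℝ × ℝ} (hab : areaForm x a b ≠ 0)
    (hp : areaForm x p b = 0) (hside : 0 ≤ areaForm x a p * areaForm x a b) :
    ∃ r : ℝ, 0 ≤ r ∧ p = x + r • (b - x) := by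
  refine ⟨areaForm x a p / areaForm x a b, ?_, ?_⟩
  · rw [← mul_div_mul_right _ _ hab]
    exact div_nonneg hside (mul_self_nonneg _)
  · ext
    · simp only [Prod.fst_add, Prod.smul_fst, Prod.fst_sub, smul_eq_mul]
      field_simp
      unfold areaForm at *
      linear_combination (a.1 - x.1) * hp
    · simp only [Prod.snd_add, Prod.smul_snd, Prod.snd_sub, smul_eq_mul]
      field_simp
      unfold areaForm at *
      linear_combination (a.2 - x.2) * hp

/-- A preconnected set avoiding the rays from `x` through `a` and `b` and meeting the segment
`[a, b]` lies in the open cone at `x` spanned by these rays. -/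
lemma IsPreconnected.subset_openCone {x a b : ℝ × ℝ} {P : Set (ℝ × ℝ)} (hP : IsPreconnected P)
    (hab : areaForm x a b ≠ 0) (hseg : (P ∩ segment ℝ a b).Nonempty)
    (ha : Disjoint P {p | ∃ r : ℝ, 0 ≤ r ∧ p = x + r • (a - x)})
    (hb : Disjoint P {p | ∃ r : ℝ, 0 ≤ r ∧ p = x + r • (b - x)}) :
    P ⊆ {p | 0 < areaForm x p b * areaForm x a b ∧ 0 < areaForm x a p * areaForm x a b} := by
  have hf : Continuous fun p => areaForm x p b * areaForm x a b := by
    unfold areaForm; fun_prop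
  have hg : Continuous fun p => areaForm x a p * areaForm x a b := by
    unfold areaForm; fun_prop
  have pos_of_nonneg : ∀ p ∈ P, 0 ≤ areaForm x p b * areaForm x a b →
      0 ≤ areaForm x a p * areaForm x a b →
      0 < areaForm x p b * areaForm x a b ∧ 0 < areaForm x a p * areaForm x a b := by
    intro p hp hfp hgp
    refine ⟨hfp.lt_of_ne' fun h0 => ?_, hgp.lt_of_ne' fun h0 => ?_⟩
    · exact Set.disjoint_left.mp hb hp
        (exists_ray_of_areaForm_eq_zero hab ((mul_eq_zero.mp h0).resolve_right hab) hgp)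
    · refine Set.disjoint_left.mp ha hp (exists_ray_of_areaForm_eq_zero (a := b) ?_ ?_ ?_)
      · rwa [areaForm_swap, neg_ne_zero]
      · rw [areaForm_swap, (mul_eq_zero.mp h0).resolve_right hab, neg_zero]
      · rwa [areaForm_swap x p b, areaForm_swap x a b, neg_mul_neg]
  refine hP.subset_left_of_subset_union
    (v := {p | areaForm x p b * areaForm x a b < 0 ∨ areaForm x a p * areaForm x a b < 0})
    ((isOpen_lt continuous_const hf).inter (isOpen_lt continuous_const hg))
    ((isOpen_lt hf continuous_const).union (isOpen_lt hg continuous_const)) ?_ ?_ ?_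
  · rw [Set.disjoint_left]
    rintro p ⟨h1, h2⟩ (h | h) <;> linarith
  · intro p hp
    by_cases h : areaForm x p b * areaForm x a b < 0 ∨ areaForm x a p * areaForm x a b < 0
    · exact Or.inr h
    · push Not at h
      exact Or.inl (pos_of_nonneg p hp h.1 h.2)
  · obtain ⟨p, hp, α, β, hα, hβ, hαβ, rfl⟩ := hseg
    have hf' : areaForm x (α • a + β • b) b = α * areaForm x a b := by
      obtain rfl : β = 1 - α := by linarith
      simp only [areaForm, Prod.fst_add, Prod.snd_add, Prod.smul_fst, Prod.smul_snd, smul_eq_mul]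
      ring
    have hg' : areaForm x a (α • a + β • b) = β * areaForm x a b := by
      obtain rfl : β = 1 - α := by linarith
      simp only [areaForm, Prod.fst_add, Prod.snd_add, Prod.smul_fst, Prod.smul_snd, smul_eq_mul]
      ring
    refine ⟨_, hp, pos_of_nonneg _ hp ?_ ?_⟩
    · rw [hf', mul_assoc]; exact mul_nonneg hα (mul_self_nonneg _)
    · rw [hg', mul_assoc]; exact mul_nonneg hβ (mul_self_nonneg _)

/-- If `a` and `c` lie strictly on opposite sides of the line through `x` and `b`, then no
preconnected set avoiding the rays from `x` through `a`, `b`, `c` meets both `[a, b]` and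
`[b, c]`. -/
lemma IsPreconnected.false_of_meets_segments {x a b c : ℝ × ℝ} {P : Set (ℝ × ℝ)}
    (hP : IsPreconnected P) (habc : 0 < areaForm x a b * areaForm x b c)
    (hab : (P ∩ segment ℝ a b).Nonempty) (hbc : (P ∩ segment ℝ b c).Nonempty)
    (ha : Disjoint P {p | ∃ r : ℝ, 0 ≤ r ∧ p = x + r • (a - x)})
    (hb : Disjoint P {p | ∃ r : ℝ, 0 ≤ r ∧ p = x + r • (b - x)})
    (hc : Disjoint P {p | ∃ r : ℝ, 0 ≤ r ∧ p = x + r • (c - x)}) : False := by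
  obtain ⟨p, hp, -⟩ := id hab
  have hpab := (hP.subset_openCone (left_ne_zero_of_mul habc.ne') hab ha hb hp).1
  have hpbc := (hP.subset_openCone (right_ne_zero_of_mul habc.ne') hbc hb hc hp).2
  rw [areaForm_swap x b p] at hpab
  nlinarith [mul_pos hpab hpbc, mul_nonneg habc.le (mul_self_nonneg (areaForm x b p))]

/-- If no three of `x, s, t, u ∈ ℝ²` are collinear, then no connected set can meet
all three segments `[s,t]`, `[t,u]`, `[u,s]` while avoiding all three rays from `x`
through `s`, `t`, and `u`. -/
theorem no_connected_blocker_avoiding_rays (x s t u : ℝ × ℝ)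
    (h1 : ¬ Collinear ℝ ({x, s, t} : Set (ℝ × ℝ)))
    (h2 : ¬ Collinear ℝ ({x, s, u} : Set (ℝ × ℝ)))
    (h3 : ¬ Collinear ℝ ({x, t, u} : Set (ℝ × ℝ)))
    (h4 : ¬ Collinear ℝ ({s, t, u} : Set (ℝ × ℝ))) :
    ¬ ∃ P : Set (ℝ × ℝ), IsConnected P ∧
        (P ∩ segment ℝ s t).Nonempty ∧
        (P ∩ segment ℝ t u).Nonempty ∧
        (P ∩ segment ℝ u s).Nonempty ∧
        ∀ w ∈ ({s, t, u} : Set (ℝ × ℝ)),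
          Disjoint P {p | ∃ r : ℝ, 0 ≤ r ∧ p = x + r • (w - x)} := by
  rintro ⟨P, hP, hst, htu, hus, hdisj⟩
  have hs := hdisj s (by simp)
  have ht := hdisj t (by simp)
  have hu := hdisj u (by simp)
  have dst : areaForm x s t ≠ 0 := fun h => h1 (collinear_of_areaForm_eq_zero h)
  have dtu : areaForm x t u ≠ 0 := fun h => h3 (collinear_of_areaForm_eq_zero h)
  have dus : areaForm x u s ≠ 0 := fun h =>
    h2 (collinear_of_areaForm_eq_zero (by rw [areaForm_swap, h, neg_zero]))
  have key_t := fun h => hP.isPreconnected.false_of_meets_segments (x := x) h hst htu hs ht hu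
  have key_u := fun h => hP.isPreconnected.false_of_meets_segments (x := x) h htu hus ht hu hs
  have key_s := fun h => hP.isPreconnected.false_of_meets_segments (x := x) h hus hst hu hs ht
  rcases dst.lt_or_gt with a | a <;> rcases dtu.lt_or_gt with b | b <;>
    rcases dus.lt_or_gt with c | c <;>
    first
    | exact key_t (mul_pos_of_neg_of_neg a b)
    | exact key_t (mul_pos a b)
    | exact key_u (mul_pos_of_neg_of_neg b c)
    | exact key_u (mul_pos b c)
    | exact key_s (mul_pos_of_neg_of_neg c a)
    | exact key_s (mul_pos c a)
end

section
/- Let G be a connected finite simple graph with at least two vertices, and fix an obstacle representation of G. Let O be one of the obstacles and let C be the union of the boundary segments of the simple polygon O. Let u be a vertex of G and let z₀, z₁, z₂ be three distinct points of C. Then there exists an index i ∈ {0, 1, 2} and a connected set γ ⊆ C with z_{i−1} ∈ γ and z_{i+1} ∈ γ (indices taken modulo 3) and z_i ∉ γ, such that γ intersects the ray starting at the placed point of u and passing through z_i (necessarily at a point different from z_i). -/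
open scoped Classical

noncomputable section

/-- If `‖b - a‖ < ‖x - a‖` for all `x` in a set, a continuous logarithm of `x - a` on the set yields
one of `x - b`. -/
theorem exists_continuousOn_log_sub_of_norm_lt {K : Set ℂ} {a b : ℂ}
    (hab : ∀ x ∈ K, ‖b - a‖ < ‖x - a‖)
    (ha : ∃ f : ℂ → ℂ, ContinuousOn f K ∧ ∀ x ∈ K, Complex.exp (f x) = x - a) :
    ∃ f : ℂ → ℂ, ContinuousOn f K ∧ ∀ x ∈ K, Complex.exp (f x) = x - b := by
  obtain ⟨f, hf, hexp⟩ := ha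
  have hne : ∀ x ∈ K, x - a ≠ 0 := fun x hx =>
    norm_pos_iff.mp ((norm_nonneg _).trans_lt (hab x hx))
  have hslit : ∀ x ∈ K, 1 + (a - b) / (x - a) ∈ Complex.slitPlane := fun x hx => by
    apply Complex.mem_slitPlane_of_norm_lt_one
    rw [norm_div, norm_sub_rev a b, div_lt_one (norm_pos_iff.mpr (hne x hx))]
    exact hab x hx
  refine ⟨fun x => f x + Complex.log (1 + (a - b) / (x - a)), hf.add ?_, fun x hx => ?_⟩
  · refine ContinuousOn.clog ?_ hslit
    exact continuousOn_const.add (continuousOn_const.div (by fun_prop) hne)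
  · rw [Complex.exp_add, hexp x hx, Complex.exp_log (Complex.slitPlane_ne_zero (hslit x hx))]
    field_simp [hne x hx]
    ring

/-- A point whose norm exceeds that of all points of a set admits a continuous logarithm of
`x - a` on the set. -/
theorem exists_continuousOn_log_sub_of_forall_norm_lt {K : Set ℂ} {a : ℂ} (ha0 : a ≠ 0)
    (ha : ∀ x ∈ K, ‖x‖ < ‖a‖) :
    ∃ f : ℂ → ℂ, ContinuousOn f K ∧ ∀ x ∈ K, Complex.exp (f x) = x - a := by
  have hslit : ∀ x ∈ K, 1 + -x / a ∈ Complex.slitPlane := fun x hx => by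
    apply Complex.mem_slitPlane_of_norm_lt_one
    rw [norm_div, norm_neg, div_lt_one (norm_pos_iff.mpr ha0)]
    exact ha x hx
  refine ⟨fun x => Complex.log (-a) + Complex.log (1 + -x / a),
    continuousOn_const.add (ContinuousOn.clog (by fun_prop) hslit), fun x hx => ?_⟩
  rw [Complex.exp_add, Complex.exp_log (neg_ne_zero.mpr ha0),
    Complex.exp_log (Complex.slitPlane_ne_zero (hslit x hx))]
  field_simp
  ring

/-- If `a` lies in an unbounded connected set disjoint from the compact set `K`, then `x - a` has
a continuous logarithm on `K`. -/
theorem exists_continuousOn_log_sub {K U : Set ℂ} (hK : IsCompact K) (hU : IsPreconnected U)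
    (hUK : Disjoint U K) (hUb : ¬ Bornology.IsBounded U) {a : ℂ} (ha : a ∈ U) :
    ∃ f : ℂ → ℂ, ContinuousOn f K ∧ ∀ x ∈ K, Complex.exp (f x) = x - a := by
  obtain ⟨M, hM⟩ := hK.isBounded.exists_norm_le
  obtain ⟨b, hbU, hb⟩ : ∃ b ∈ U, max M 0 < ‖b‖ := by
    by_contra! h
    exact hUb (isBounded_iff_forall_norm_le.mpr ⟨_, h⟩)
  have hlocal : ∀ x ∈ U, ∀ᶠ y in nhdsWithin x U,
      ((∃ f : ℂ → ℂ, ContinuousOn f K ∧ ∀ w ∈ K, Complex.exp (f w) = w - x) ↔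
        ∃ f : ℂ → ℂ, ContinuousOn f K ∧ ∀ w ∈ K, Complex.exp (f w) = w - y) := by
    intro x hx
    obtain ⟨ε, hε, hball⟩ := Metric.isOpen_iff.mp hK.isClosed.isOpen_compl x
      (Set.disjoint_left.mp hUK hx)
    have hdist : ∀ w ∈ K, ε ≤ ‖w - x‖ := fun w hw => by
      by_contra! hlt
      exact hball (mem_ball_iff_norm.mpr hlt) hw
    refine Filter.Eventually.filter_mono nhdsWithin_le_nhds ?_
    filter_upwards [Metric.ball_mem_nhds x (half_pos hε)] with y hy
    have hy' : ‖y - x‖ < ε / 2 := mem_ball_iff_norm.mp hy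
    constructor
    · exact exists_continuousOn_log_sub_of_norm_lt fun w hw => by linarith [hdist w hw]
    · refine exists_continuousOn_log_sub_of_norm_lt fun w hw => ?_
      have := norm_sub_le_norm_sub_add_norm_sub w y x
      rw [norm_sub_rev x y]
      linarith [hdist w hw]
  refine (hU.induction₂ _ hlocal (fun _ _ _ _ _ _ => Iff.trans) (fun _ _ _ _ => Iff.symm)
    hbU ha).mp (exists_continuousOn_log_sub_of_forall_norm_lt ?_ fun x hx => ?_)
  · exact norm_pos_iff.mp ((le_max_right M 0).trans_lt hb)
  · exact ((hM x hx).trans (le_max_left M 0)).trans_lt hb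

/-- If `p` lies in an unbounded component of the complement of a compact planar set, there is a
continuous function on the set whose level sets lie on rays from `p`. -/
theorem exists_continuousOn_angle {C : Set (ℝ × ℝ)} (hC : IsCompact C) {p : ℝ × ℝ} (hp : p ∉ C)
    (hb : ¬ Bornology.IsBounded (connectedComponentIn Cᶜ p)) :
    ∃ θ : ℝ × ℝ → ℝ, ContinuousOn θ C ∧ ∀ x ∈ C, ∀ y ∈ C, θ x = θ y →
      ∃ r : ℝ, 0 ≤ r ∧ x = p + r • (y - p) := by
  let e := Complex.equivRealProdCLM.symm
  obtain ⟨f, hf, hexp⟩ := exists_continuousOn_log_sub (K := e '' C)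
    (U := e '' connectedComponentIn Cᶜ p) (hC.image e.continuous)
    (isPreconnected_connectedComponentIn.image e e.continuous.continuousOn)
    ((Set.disjoint_image_iff e.injective).mpr
      (Set.disjoint_left.mpr fun x hx => connectedComponentIn_subset _ _ hx))
    (fun h => hb (by
      have := e.symm.lipschitz.isBounded_image h
      rwa [Set.image_image, funext e.symm_apply_apply, Set.image_id'] at this))
    (Set.mem_image_of_mem e (mem_connectedComponentIn hp))
  refine ⟨fun x => (f (e x)).im, Complex.continuous_im.comp_continuousOn
    (hf.comp e.continuous.continuousOn (Set.mapsTo_image e C)), fun x hx y hy hxy => ?_⟩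
  refine ⟨Real.exp ((f (e x)).re - (f (e y)).re), (Real.exp_pos _).le, ?_⟩
  rw [← sub_eq_iff_eq_add']
  apply e.injective
  have hfx : Complex.exp (f (e x)) =
      Complex.exp ((f (e x)).re - (f (e y)).re : ℝ) * Complex.exp (f (e y)) := by
    rw [← Complex.exp_add]
    congr 1
    apply Complex.ext <;> simp [hxy]
  rw [map_smul, map_sub, map_sub, ← hexp _ (Set.mem_image_of_mem e hx),
    ← hexp _ (Set.mem_image_of_mem e hy), hfx, Complex.real_smul,
    Complex.ofReal_exp]

namespace SimplePolygon

variable (P : SimplePolygon)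

theorem isCompact_boundary : IsCompact P.boundary := by
  have : NeZero P.k := ⟨by have := P.three_le; omega⟩
  refine isCompact_iUnion fun i => ?_
  rw [segment_eq_image]
  exact isCompact_Icc.image (by fun_prop)

theorem segment_subset_boundary (i : ZMod P.k) :
    segment ℝ (P.verts i) (P.verts (i + 1)) ⊆ P.boundary :=
  Set.subset_iUnion (fun i => segment ℝ (P.verts i) (P.verts (i + 1))) i

/-- Every boundary point lies on a boundary segment of which it is not the final endpoint. -/
theorem exists_mem_segment_ne {z : ℝ × ℝ} (hz : z ∈ P.boundary) :
    ∃ i, z ∈ segment ℝ (P.verts i) (P.verts (i + 1)) ∧ z ≠ P.verts (i + 1) := by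
  have : Fact (1 < P.k) := ⟨by have := P.three_le; omega⟩
  obtain ⟨i, hi⟩ := Set.mem_iUnion.mp hz
  by_cases h : z = P.verts (i + 1)
  · refine ⟨i + 1, h ▸ left_mem_segment ℝ _ _, fun h' => ?_⟩
    have := P.inj (h.symm.trans h')
    simp at this
  · exact ⟨i, hi, h⟩

variable {P}

/-- A point of the `i`-th segment other than its final endpoint lies on no other segment, except
possibly the preceding one. -/
theorem notMem_segment_add {z : ℝ × ℝ} {i : ZMod P.k}
    (hz : z ∈ segment ℝ (P.verts i) (P.verts (i + 1))) (hne : z ≠ P.verts (i + 1))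
    {n : ℕ} (hn : 1 ≤ n) (hnk : n + 2 ≤ P.k) :
    z ∉ segment ℝ (P.verts (i + n)) (P.verts (i + n + 1)) := by
  intro hmem
  have hcast : ∀ m : ℕ, 0 < m → m < P.k → (m : ZMod P.k) ≠ 0 := fun m h0 hm h =>
    absurd (Nat.le_of_dvd h0 ((ZMod.natCast_eq_zero_iff m P.k).mp h)) (by omega)
  obtain rfl | hn := hn.eq_or_lt
  · have : z ∈ ({P.verts (i + 1)} : Set (ℝ × ℝ)) := by
      rw [← P.consec i]
      refine ⟨hz, ?_⟩
      rw [← one_add_one_eq_two, ← add_assoc]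
      simpa using hmem
    exact hne this
  · refine Set.disjoint_left.mp (P.nonconsec i (i + n) ?_ ?_ ?_) hz hmem
    · simpa using hcast n (by omega) (by omega)
    · intro h
      apply hcast (n - 1) (by omega) (by omega)
      rw [Nat.cast_sub hn.le, add_left_cancel h, Nat.cast_one, sub_self]
    · intro h
      apply hcast (n + 1) (by omega) (by omega)
      rw [add_assoc, left_eq_add] at h
      exact_mod_cast h

/-- Removing a point from the boundary of a simple polygon leaves a connected set. -/
theorem isConnected_boundary_diff_singleton {z : ℝ × ℝ} (hz : z ∈ P.boundary) :
    IsConnected (P.boundary \ {z}) := by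
  have hk := P.three_le
  have : NeZero P.k := ⟨by omega⟩
  obtain ⟨i, hi, hne⟩ := P.exists_mem_segment_ne hz
  have hstart : P.verts (i + 1) ∈ P.boundary \ {z} :=
    ⟨P.segment_subset_boundary i (right_mem_segment ℝ _ _), Ne.symm hne⟩
  have hjoin : ∀ (j : ZMod P.k) (x y : ℝ × ℝ), x ∈ segment ℝ (P.verts j) (P.verts (j + 1)) →
      y ∈ segment ℝ (P.verts j) (P.verts (j + 1)) → z ∉ segment ℝ x y →
      JoinedIn (P.boundary \ {z}) x y := by
    intro j x y hx hy hzxy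
    refine JoinedIn.of_segment_subset fun w hw => ⟨P.segment_subset_boundary j
      ((convex_segment _ _).segment_subset hx hy hw), ?_⟩
    rintro rfl
    exact hzxy hw
  have hvert : ∀ n : ℕ, n + 2 ≤ P.k →
      JoinedIn (P.boundary \ {z}) (P.verts (i + 1)) (P.verts (i + n + 1)) := by
    intro n
    induction n with
    | zero =>
      intro _
      simpa using JoinedIn.refl hstart
    | succ n ih =>
      intro hn
      refine (ih (by omega)).trans ?_
      have hcast : i + n + 1 = i + ((n + 1 : ℕ) : ZMod P.k) := by push_cast; ring
      rw [hcast]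
      exact hjoin _ _ _ (left_mem_segment ℝ _ _) (right_mem_segment ℝ _ _)
        (notMem_segment_add hi hne (by omega) hn)
  have hlast : i + ((P.k - 2 : ℕ) : ZMod P.k) + 1 + 1 = i := by
    rw [add_assoc, add_assoc, one_add_one_eq_two, Nat.cast_sub (by omega)]
    simp
  -- the segment ending at the initial endpoint of the segment containing `z`
  have hprev : ∀ x ∈ segment ℝ (P.verts (i + ((P.k - 2 : ℕ) : ZMod P.k) + 1)) (P.verts i),
      x ≠ z → JoinedIn (P.boundary \ {z}) (P.verts (i + 1)) x := by
    intro x hx hxz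
    refine (hvert (P.k - 2) (by omega)).trans ?_
    refine hjoin (i + ((P.k - 2 : ℕ) : ZMod P.k) + 1) _ _ (left_mem_segment ℝ _ _)
      (by rwa [hlast]) fun hmem => ?_
    have hconsec := P.consec (i + ((P.k - 2 : ℕ) : ZMod P.k) + 1)
    rw [← one_add_one_eq_two (R := ZMod P.k), ← add_assoc, hlast] at hconsec
    have hzi : z ∈ ({P.verts i} : Set (ℝ × ℝ)) := hconsec ▸
      ⟨(convex_segment _ _).segment_subset (left_mem_segment ℝ _ _) hx hmem, hi⟩
    rw [Set.mem_singleton_iff] at hzi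
    subst hzi
    rw [mem_segment_iff_wbtw] at hx hmem
    exact hxz (hx.swap_right_iff.mp hmem)
  refine IsPathConnected.isConnected ⟨P.verts (i + 1), hstart, fun {x} hx => ?_⟩
  obtain ⟨hxC, hxz⟩ := hx
  rw [Set.mem_singleton_iff] at hxz
  obtain ⟨j, hj⟩ := Set.mem_iUnion.mp hxC
  obtain ⟨n, hn, rfl⟩ : ∃ n : ℕ, n < P.k ∧ j = i + n :=
    ⟨(j - i).val, ZMod.val_lt _, by simp⟩
  obtain rfl | hn0 := Nat.eq_zero_or_pos n
  · rw [Nat.cast_zero, add_zero] at hj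
    by_cases h₁ : z ∈ segment ℝ (P.verts (i + 1)) x
    · have h₀ : z ∉ segment ℝ (P.verts i) x := fun h₀ => by
        rw [mem_segment_iff_wbtw] at h₁ h₀ hj
        exact hxz ((hj.trans_right_left h₁.symm).swap_right_iff.mp h₀)
      exact (hprev _ (right_mem_segment ℝ _ _) fun h => h₀ (h ▸ left_mem_segment ℝ _ _)).trans
        (hjoin i _ _ (left_mem_segment ℝ _ _) hj h₀)
    · exact hjoin i _ _ (right_mem_segment ℝ _ _) hj h₁
  · have hcast : i + ((n - 1 : ℕ) : ZMod P.k) + 1 = i + n := by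
      rw [Nat.cast_sub hn0]; push_cast; ring
    by_cases hnk : n + 2 ≤ P.k
    · have hv := hvert (n - 1) (by omega)
      rw [hcast] at hv
      refine hv.trans (hjoin _ _ _ (left_mem_segment ℝ _ _) hj fun hmem => ?_)
      exact notMem_segment_add hi hne hn0 hnk
        ((convex_segment _ _).segment_subset (left_mem_segment ℝ _ _) hj hmem)
    · obtain rfl : n = P.k - 1 := by omega
      rw [show P.k - 1 - 1 = P.k - 2 by omega] at hcast
      rw [← hcast, hlast] at hj
      exact hprev x hj hxz

end SimplePolygon

/-- Among three values indexed by `Fin 3`, one lies between its two cyclic neighbours. -/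
theorem exists_mem_uIcc_sub_one_add_one {α : Type*} [LinearOrder α] (t : Fin 3 → α) :
    ∃ j : Fin 3, t j ∈ Set.uIcc (t (j - 1)) (t (j + 1)) := by
  have h0 : (0 - 1 : Fin 3) = 2 := rfl
  have h1 : (1 + 1 : Fin 3) = 2 := rfl
  have h2 : (2 - 1 : Fin 3) = 1 := rfl
  have h3 : (2 + 1 : Fin 3) = 0 := rfl
  simp only [Fin.exists_fin_succ, Set.mem_uIcc]
  simp [h0, h1, h2, h3]
  grind

/-- Let `G` be a connected graph with at least two vertices, with an obstacle
representation, let `O` be one of its obstacles with boundary `C`, let `u` be a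
vertex and `z₀, z₁, z₂` three distinct points of `C`. Then for some `i`, a connected
subset `γ` of `C` contains `z_{i-1}` and `z_{i+1}`, avoids `z_i`, and meets the ray
from the placed point of `u` through `z_i`. -/
theorem boundary_chain_meets_ray {V : Type*} [Fintype V] (G : SimpleGraph V)
    (hconn : G.Connected) (hcard : 2 ≤ Fintype.card V)
    (R : ObstacleRep G) (i₀ : Fin R.numObs) (u : V)
    (z : Fin 3 → ℝ × ℝ) (hzinj : Function.Injective z)
    (hzC : ∀ j, z j ∈ (R.obs i₀).boundary) :
    ∃ j : Fin 3, ∃ γ : Set (ℝ × ℝ),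
      γ ⊆ (R.obs i₀).boundary ∧ IsConnected γ ∧
      z (j - 1) ∈ γ ∧ z (j + 1) ∈ γ ∧ z j ∉ γ ∧
      ∃ p ∈ γ, ∃ r : ℝ, 0 ≤ r ∧ p = R.pos u + r • (z j - R.pos u) := by
  have : Nontrivial V := Fintype.one_lt_card_iff_nontrivial.mp hcard
  obtain ⟨v, hv⟩ := hconn.preconnected.exists_adj_of_nontrivial u
  have hu : R.pos u ∉ (R.obs i₀).toSet :=
    Set.disjoint_left.mp (R.edges_clear u v hv i₀) (left_mem_segment ℝ _ _)
  have huC : R.pos u ∉ (R.obs i₀).boundary := fun h => hu (Or.inl h)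
  obtain ⟨θ, hθ, hray⟩ := exists_continuousOn_angle (R.obs i₀).isCompact_boundary huC
    fun h => hu (Or.inr ⟨huC, h⟩)
  obtain ⟨j, hj⟩ := exists_mem_uIcc_sub_one_add_one fun i => θ (z i)
  have hconn' := SimplePolygon.isConnected_boundary_diff_singleton (hzC j)
  have hprev : z (j - 1) ∈ (R.obs i₀).boundary \ {z j} :=
    ⟨hzC _, fun h => by simpa using hzinj h⟩
  have hnext : z (j + 1) ∈ (R.obs i₀).boundary \ {z j} :=
    ⟨hzC _, fun h => by simpa using hzinj h⟩
  obtain ⟨p, hp, hpθ⟩ := ((hconn'.isPreconnected.image θ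
    (hθ.mono Set.sdiff_subset)).ordConnected.uIcc_subset
    (Set.mem_image_of_mem θ hprev) (Set.mem_image_of_mem θ hnext)) hj
  exact ⟨j, _, Set.sdiff_subset, hconn', hprev, hnext, fun h => h.2 rfl, p, hp,
    hray p hp.1 (z j) (hzC j) hpθ⟩
end
end

section
/- There is a constant c > 0 such that every finite simple graph with n ≥ 1 vertices and m edges admits an obstacle representation in which the total number of polygon vertices of all obstacles (summed over all obstacles of the representation) is at most c·(m² + n). -/
open scoped Classical

noncomputable section

/-- Two segments spanned by three affinely independent points meet only in the shared endpoint. -/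
lemma segment_inter_segment_eq_of_cross_ne_zero {A B C : ℝ × ℝ}
    (h : (A.1 - B.1) * (C.2 - B.2) - (A.2 - B.2) * (C.1 - B.1) ≠ 0) :
    segment ℝ A B ∩ segment ℝ B C = {B} := by
  ext x
  constructor
  · rintro ⟨⟨a, b, -, -, hab, rfl⟩, ⟨c, d, -, -, hcd, hx⟩⟩
    have h1 := congrArg Prod.fst hx
    have h2 := congrArg Prod.snd hx
    simp only [Prod.fst_add, Prod.snd_add, Prod.smul_fst, Prod.smul_snd, smul_eq_mul] at h1 h2
    obtain rfl : c = 1 - d := by linarith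
    obtain rfl : b = 1 - a := by linarith
    have ha : a = 0 := by
      refine (mul_eq_zero.mp (?_ : a * _ = 0)).resolve_right h
      linear_combination (C.1 - B.1) * h2 - (C.2 - B.2) * h1
    simp [ha]
  · rintro rfl
    exact ⟨right_mem_segment ℝ _ _, left_mem_segment ℝ _ _⟩

/-- The right triangle with corner `p` and legs of length `ε` parallel to the axes. -/
def SimplePolygon.rightTriangle (p : ℝ × ℝ) (ε : ℝ) (hε : 0 < ε) : SimplePolygon where
  k := 3
  three_le := le_rfl
  verts := (![p, p + (ε, 0), p + (0, ε)] : Fin 3 → ℝ × ℝ)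
  inj := by
    change Function.Injective (![p, p + (ε, 0), p + (0, ε)] : Fin 3 → ℝ × ℝ)
    intro i j hij
    fin_cases i <;> fin_cases j <;> simp_all [Prod.ext_iff, hε.ne']
  consec := by
    change ∀ i : Fin 3, segment ℝ ((![p, p + (ε, 0), p + (0, ε)] : Fin 3 → ℝ × ℝ) i)
      ((![p, p + (ε, 0), p + (0, ε)] : Fin 3 → ℝ × ℝ) (i + 1)) ∩
      segment ℝ ((![p, p + (ε, 0), p + (0, ε)] : Fin 3 → ℝ × ℝ) (i + 1))
      ((![p, p + (ε, 0), p + (0, ε)] : Fin 3 → ℝ × ℝ) (i + 2)) = _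
    intro i
    apply segment_inter_segment_eq_of_cross_ne_zero
    fin_cases i <;> simp [hε.ne']
  nonconsec := by
    intro i j h1 h2 h3
    exact absurd h3 (by revert i j; decide)

lemma SimplePolygon.mem_toSet_rightTriangle (p : ℝ × ℝ) {ε : ℝ} (hε : 0 < ε) :
    p ∈ (rightTriangle p ε hε).toSet :=
  Or.inl (Set.mem_iUnion.2 ⟨(0 : Fin 3), left_mem_segment ℝ _ _⟩)

/-- A polygon whose boundary lies in a closed ball is itself contained in that ball. -/
lemma SimplePolygon.toSet_subset_closedBall {P : SimplePolygon} {p : ℝ × ℝ} {ε : ℝ}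
    (h : P.boundary ⊆ Metric.closedBall p ε) : P.toSet ⊆ Metric.closedBall p ε := by
  rintro x (hx | ⟨-, hx⟩)
  · exact h hx
  by_contra hxp
  rw [Metric.mem_closedBall, not_le, dist_eq_norm] at hxp
  have hpos : 0 < ‖x - p‖ := by
    refine norm_pos_iff.2 fun h0 => ?_
    obtain ⟨y, hy⟩ : P.boundary.Nonempty :=
      ⟨P.verts 0, Set.mem_iUnion.2 ⟨0, left_mem_segment ℝ _ _⟩⟩
    have := dist_nonneg.trans (Metric.mem_closedBall.1 (h hy))
    rw [h0, norm_zero] at hxp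
    exact absurd hxp (not_lt.2 this)
  let ray : ℝ → ℝ × ℝ := fun s => p + s • (x - p)
  have hnorm : ∀ s : ℝ, 1 ≤ s → dist (ray s) p = s * ‖x - p‖ := fun s hs => by
    simp only [ray, dist_eq_norm, add_sub_cancel_left, norm_smul, Real.norm_eq_abs,
      abs_of_nonneg (zero_le_one.trans hs)]
  have hsub : ray '' Set.Ici 1 ⊆ connectedComponentIn P.boundaryᶜ x := by
    refine IsPreconnected.subset_connectedComponentIn ?_ ⟨1, Set.self_mem_Ici, by simp [ray]⟩ ?_
    · exact isPreconnected_Ici.image _ (by fun_prop)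
    · rintro _ ⟨s, hs, rfl⟩ hmem
      have h1 := Metric.mem_closedBall.1 (h hmem)
      rw [hnorm s hs] at h1
      nlinarith [Set.mem_Ici.1 hs]
  obtain ⟨r, hr⟩ := (hx.subset hsub).subset_closedBall p
  have hs : (1 : ℝ) ≤ 1 + |r| / ‖x - p‖ := le_add_of_nonneg_right (by positivity)
  have h2 := Metric.mem_closedBall.1 (hr ⟨_, hs, rfl⟩)
  rw [hnorm _ hs, add_mul, div_mul_cancel₀ _ hpos.ne'] at h2
  linarith [le_abs_self r]

lemma SimplePolygon.toSet_rightTriangle_subset (p : ℝ × ℝ) {ε : ℝ} (hε : 0 < ε) :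
    (rightTriangle p ε hε).toSet ⊆ Metric.closedBall p ε := by
  have hv : ∀ i : Fin 3,
      (![p, p + (ε, 0), p + (0, ε)] : Fin 3 → ℝ × ℝ) i ∈ Metric.closedBall p ε := by
    intro i
    fin_cases i <;> simp [dist_eq_norm, Prod.norm_def, abs_of_pos hε, hε.le]
  exact toSet_subset_closedBall <| Set.iUnion_subset fun i =>
    (convex_closedBall p ε).segment_subset (hv i) (hv _)

/-- A chord of the parabola `y = x²` lies on the line through its endpoints. -/
lemma chord_equation {a b : ℝ} {p : ℝ × ℝ} (h : p ∈ segment ℝ (a, a ^ 2) (b, b ^ 2)) :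
    p.2 - (a + b) * p.1 + a * b = 0 := by
  obtain ⟨s, t, -, -, hst, rfl⟩ := h
  obtain rfl : s = 1 - t := by linarith
  simp only [Prod.fst_add, Prod.snd_add, Prod.smul_fst, Prod.smul_snd, smul_eq_mul]
  ring

lemma not_collinear_parabola {a b c : ℝ} (hab : a ≠ b) (hac : a ≠ c) (hbc : b ≠ c) :
    ¬ Collinear ℝ ({(a, a ^ 2), (b, b ^ 2), (c, c ^ 2)} : Set (ℝ × ℝ)) := by
  rw [collinear_iff_of_mem (p₀ := (a, a ^ 2)) (by simp)]
  rintro ⟨v, hv⟩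
  obtain ⟨r, hr⟩ := hv (b, b ^ 2) (by simp)
  obtain ⟨s, hs⟩ := hv (c, c ^ 2) (by simp)
  simp only [Prod.ext_iff, vadd_eq_add, Prod.fst_add, Prod.snd_add, Prod.smul_fst,
    Prod.smul_snd, smul_eq_mul] at hr hs
  have : (a - b) * ((a - c) * (c - b)) = 0 := by
    linear_combination (s * v.2) * hr.1 - (s * v.1) * hr.2 + (b - a) * hs.2
      - (b ^ 2 - a ^ 2) * hs.1
  simp [sub_eq_zero, hab, hac, hbc.symm] at this

/-- A chord of the parabola contains a point avoiding any finite family of other chords. -/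
lemma exists_mem_chord_avoiding {u v : ℝ} (T : Finset (ℝ × ℝ))
    (hT : ∀ q ∈ T, (u - q.1) * (u - q.2) ≠ 0 ∨ (v - q.1) * (v - q.2) ≠ 0) :
    ∃ p ∈ segment ℝ (u, u ^ 2) (v, v ^ 2),
      ∀ q ∈ T, p ∉ segment ℝ (q.1, q.1 ^ 2) (q.2, q.2 ^ 2) := by
  let bad : ℝ × ℝ → Set ℝ := fun q =>
    {t | (1 - t) * ((u - q.1) * (u - q.2)) + t * ((v - q.1) * (v - q.2)) = 0}
  have hfin : (⋃ q ∈ T, bad q).Finite := by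
    refine T.finite_toSet.biUnion fun q hq => Set.Subsingleton.finite fun s hs t ht => ?_
    simp only [bad, Set.mem_ofPred_eq] at hs ht
    set α := (u - q.1) * (u - q.2)
    set β := (v - q.1) * (v - q.2)
    by_contra hne
    have hα : (s - t) * α = 0 := by linear_combination s * ht - t * hs
    have hβ : (s - t) * β = 0 := by linear_combination (1 - t) * hs - (1 - s) * ht
    have hst : s - t ≠ 0 := sub_ne_zero.2 hne
    exact (hT q hq).elim (· ((mul_eq_zero.1 hα).resolve_left hst))
      (· ((mul_eq_zero.1 hβ).resolve_left hst))
  obtain ⟨t, ht, htbad⟩ := (Set.Icc_infinite (zero_lt_one (α := ℝ))).exists_notMem_finite hfin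
  refine ⟨(1 - t) • (u, u ^ 2) + t • (v, v ^ 2),
    ⟨1 - t, t, by linarith [ht.2], ht.1, by ring, rfl⟩, fun q hq hmem => htbad ?_⟩
  have h := chord_equation hmem
  simp only [Prod.fst_add, Prod.snd_add, Prod.smul_fst, Prod.smul_snd, smul_eq_mul] at h
  exact Set.mem_biUnion hq (show _ = (0 : ℝ) by linear_combination h)

/-- Finitely many points off a closed set have a common radius for which the closed balls around
them are pairwise disjoint and avoid the set. -/
lemma exists_radius_separating {X : Type*} [MetricSpace X] (S : Finset X) {E : Set X}
    (hE : IsClosed E) (hSE : ∀ p ∈ S, p ∉ E) :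
    ∃ ε : ℝ, 0 < ε ∧ (∀ p ∈ S, Disjoint E (Metric.closedBall p ε)) ∧
      ∀ p ∈ S, ∀ q ∈ S, p ≠ q →
        Disjoint (Metric.closedBall p ε) (Metric.closedBall q ε) := by
  have h1 : ∀ᶠ ε : ℝ in nhdsWithin 0 (Set.Ioi 0),
      ∀ p ∈ S, Disjoint E (Metric.closedBall p ε) := by
    refine (Filter.eventually_all_finset S).2 fun p hp => ?_
    obtain ⟨δ, hδ, hsub⟩ := Metric.isOpen_iff.1 hE.isOpen_compl p (hSE p hp)
    filter_upwards [Ioo_mem_nhdsGT hδ] with ε hε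
    exact (Set.disjoint_left.2 fun x hx =>
      hsub (Metric.closedBall_subset_ball hε.2 hx)).symm
  have h2 : ∀ᶠ ε : ℝ in nhdsWithin 0 (Set.Ioi 0), ∀ p ∈ S, ∀ q ∈ S, p ≠ q →
      Disjoint (Metric.closedBall p ε) (Metric.closedBall q ε) := by
    refine (Filter.eventually_all_finset S).2 fun p _ =>
      (Filter.eventually_all_finset S).2 fun q _ => ?_
    by_cases hpq : p = q
    · simp [hpq]
    filter_upwards [Ioo_mem_nhdsGT (half_pos (dist_pos.2 hpq))] with ε hε _
    exact Metric.closedBall_disjoint_closedBall (by linarith [hε.2])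
  obtain ⟨ε, ⟨h1, h2⟩, hε⟩ := ((h1.and h2).and self_mem_nhdsWithin).exists
  exact ⟨ε, hε, h1, h2⟩

/-- A placement in general position and a finite set of points that avoids all edges and meets all
non-edges yield a representation by triangles, one for each of the points. -/
lemma exists_obstacleRep_of_hitting {V : Type*} [Finite V] (G : SimpleGraph V) (pos : V → ℝ × ℝ)
    (posInj : Function.Injective pos)
    (genPos : ∀ u v w : V, u ≠ v → u ≠ w → v ≠ w →
      ¬ Collinear ℝ ({pos u, pos v, pos w} : Set (ℝ × ℝ)))
    (S : Finset (ℝ × ℝ))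
    (hclear : ∀ p ∈ S, ∀ u v, G.Adj u v → p ∉ segment ℝ (pos u) (pos v))
    (hhit : ∀ u v, u ≠ v → ¬ G.Adj u v → ∃ p ∈ S, p ∈ segment ℝ (pos u) (pos v)) :
    ∃ R : ObstacleRep G, ∑ i : Fin R.numObs, (R.obs i).k = 3 * S.card := by
  have hclosed : IsClosed (⋃ q : {q : V × V // G.Adj q.1 q.2},
      segment ℝ (pos q.1.1) (pos q.1.2)) := by
    refine isClosed_iUnion_of_finite fun q => ?_
    rw [segment_eq_image]
    exact (isCompact_Icc.image (by fun_prop)).isClosed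
  obtain ⟨ε, hε, hedge, hsep⟩ := exists_radius_separating S hclosed fun p hp hmem => by
    obtain ⟨q, hq⟩ := Set.mem_iUnion.1 hmem
    exact hclear p hp _ _ q.2 hq
  have hsub := fun p => SimplePolygon.toSet_rightTriangle_subset p hε
  refine ⟨{
    pos := pos
    posInj := posInj
    genPos := genPos
    numObs := S.card
    obs := fun i => SimplePolygon.rightTriangle (S.equivFin.symm i) ε hε
    disj := fun i j hij => (hsep _ (S.equivFin.symm i).2 _ (S.equivFin.symm j).2
      fun h => hij (S.equivFin.symm.injective (Subtype.ext h))).mono (hsub _) (hsub _)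
    edges_clear := fun u v huv i => (hedge _ (S.equivFin.symm i).2).mono
      (Set.subset_iUnion (fun q : {q : V × V // G.Adj q.1 q.2} =>
        segment ℝ (pos q.1.1) (pos q.1.2)) ⟨(u, v), huv⟩) (hsub _)
    nonedges_blocked := fun u v huv hadj => by
      obtain ⟨p, hp, hps⟩ := hhit u v huv hadj
      refine ⟨S.equivFin ⟨p, hp⟩, p, hps, ?_⟩
      simpa using SimplePolygon.mem_toSet_rightTriangle p hε }, ?_⟩
  simp [SimplePolygon.rightTriangle, mul_comm]

/-- A graph with `m` edges has at most `2 * m` non-isolated vertices. -/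
lemma card_support_le_two_mul_card_edges {V : Type*} [Fintype V] (G : SimpleGraph V) :
    (Finset.univ.filter fun v => ∃ w, G.Adj v w).card ≤ 2 * Nat.card G.edgeSet := by
  have h : (Finset.univ.filter fun v => ∃ w, G.Adj v w) ⊆
      Finset.univ.image fun d : G.Dart => d.fst := by
    intro v hv
    obtain ⟨w, hw⟩ := (Finset.mem_filter.1 hv).2
    exact Finset.mem_image.2 ⟨⟨(v, w), hw⟩, Finset.mem_univ _, rfl⟩
  refine (Finset.card_le_card h).trans (Finset.card_image_le.trans ?_)
  rw [Finset.card_univ, G.dart_card_eq_twice_card_edges, SimpleGraph.edgeFinset_card,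
    Nat.card_eq_fintype_card]

/-- There is a constant `c > 0` such that every finite graph with `n ≥ 1` vertices
and `m` edges has an obstacle representation whose total number of obstacle polygon
vertices is at most `c·(m² + n)`. -/
theorem obstacle_representation_complexity_bound :
    ∃ c : ℝ, 0 < c ∧ ∀ (V : Type) [Fintype V] (G : SimpleGraph V),
      1 ≤ Fintype.card V →
      ∃ R : ObstacleRep G,
        ((∑ i : Fin R.numObs, (R.obs i).k : ℕ) : ℝ) ≤
          c * ((Nat.card G.edgeSet : ℝ) ^ 2 + (Fintype.card V : ℝ)) := by
  refine ⟨12, by norm_num, fun V _ G _ => ?_⟩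
  let x : V → ℝ := fun v => (Fintype.equivFin V v : ℕ)
  have hx : Function.Injective x := fun u v h =>
    (Fintype.equivFin V).injective (Fin.ext (Nat.cast_injective h))
  let pos : V → ℝ × ℝ := fun v => (x v, x v ^ 2)
  have hpoint : ∀ u v, ∃ p : ℝ × ℝ, u ≠ v → ¬ G.Adj u v →
      p ∈ segment ℝ (pos u) (pos v) ∧
        ∀ a b, G.Adj a b → p ∉ segment ℝ (pos a) (pos b) := by
    intro u v
    by_cases h : u ≠ v ∧ ¬ G.Adj u v
    · obtain ⟨p, hp, hp'⟩ := exists_mem_chord_avoiding (u := x u) (v := x v)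
        ((Finset.univ.filter fun q : V × V => G.Adj q.1 q.2).image fun q => (x q.1, x q.2)) (by
          simp only [Finset.mem_image, Finset.mem_filter, Finset.mem_univ, true_and]
          rintro _ ⟨⟨a, b⟩, hab, rfl⟩
          by_contra! h0
          simp only [mul_eq_zero, sub_eq_zero, hx.eq_iff] at h0 hab
          rcases h0 with ⟨rfl | rfl, rfl | rfl⟩
          · exact h.1 rfl
          · exact h.2 hab
          · exact h.2 hab.symm
          · exact h.1 rfl)
      exact ⟨p, fun _ _ => ⟨hp, fun a b hab => hp' (x a, x b) <| Finset.mem_image.2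
        ⟨(a, b), Finset.mem_filter.2 ⟨Finset.mem_univ _, hab⟩, rfl⟩⟩⟩
    · exact ⟨0, fun h1 h2 => (h ⟨h1, h2⟩).elim⟩
  choose g hg using hpoint
  let N : Finset V := Finset.univ.filter fun v => ∃ w, G.Adj v w
  let pairs : Finset (V × V) := (N ×ˢ N).filter fun q => q.1 ≠ q.2 ∧ ¬ G.Adj q.1 q.2
  let S : Finset (ℝ × ℝ) := Nᶜ.image pos ∪ pairs.image fun q => g q.1 q.2
  have hmemN : ∀ v, v ∈ N ↔ ∃ w, G.Adj v w := fun v => by simp [N]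
  obtain ⟨R, hR⟩ := exists_obstacleRep_of_hitting G pos
    (fun u v h => hx (congrArg Prod.fst h))
    (fun u v w huv huw hvw =>
      not_collinear_parabola (hx.ne huv) (hx.ne huw) (hx.ne hvw)) S
    (by
      intro p hp a b hab
      rcases Finset.mem_union.1 hp with hp | hp
      · obtain ⟨v, hv, rfl⟩ := Finset.mem_image.1 hp
        rw [Finset.mem_compl, hmemN] at hv
        intro hmem
        have h0 : (x v - x a) * (x v - x b) = 0 := by
          linear_combination chord_equation hmem
        simp only [mul_eq_zero, sub_eq_zero, hx.eq_iff] at h0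
        rcases h0 with rfl | rfl
        · exact hv ⟨_, hab⟩
        · exact hv ⟨_, hab.symm⟩
      · obtain ⟨q, hq, rfl⟩ := Finset.mem_image.1 hp
        have hq := (Finset.mem_filter.1 hq).2
        exact (hg _ _ hq.1 hq.2).2 a b hab)
    (by
      intro u v huv hadj
      by_cases hu : u ∈ N
      · by_cases hv : v ∈ N
        · exact ⟨g u v, Finset.mem_union_right _ (Finset.mem_image.2 ⟨(u, v), Finset.mem_filter.2
            ⟨Finset.mem_product.2 ⟨hu, hv⟩, huv, hadj⟩, rfl⟩), (hg u v huv hadj).1⟩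
        · exact ⟨pos v, Finset.mem_union_left _ (Finset.mem_image_of_mem _
            (Finset.mem_compl.2 hv)), right_mem_segment ℝ _ _⟩
      · exact ⟨pos u, Finset.mem_union_left _ (Finset.mem_image_of_mem _
          (Finset.mem_compl.2 hu)), left_mem_segment ℝ _ _⟩)
  refine ⟨R, ?_⟩
  have hN : N.card ≤ 2 * Nat.card G.edgeSet := card_support_le_two_mul_card_edges G
  have hpairs : pairs.card ≤ N.card * N.card :=
    (Finset.card_filter_le _ _).trans (Finset.card_product _ _).le
  have hS : S.card ≤ Fintype.card V + N.card * N.card :=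
    (Finset.card_union_le _ _).trans <| add_le_add
      (Finset.card_image_le.trans (Finset.card_le_univ _)) (Finset.card_image_le.trans hpairs)
  have hbound : 3 * S.card ≤ 12 * (Nat.card G.edgeSet ^ 2 + Fintype.card V) := by
    nlinarith [Nat.mul_le_mul hN hN]
  rw [hR]
  exact_mod_cast hbound
end
end

section
/- There exists a function f : ℕ → ℕ with the following property. Let G be a finite simple graph, let X be a vertex cover of G with |X| = k, and let T be a set of vertices of G disjoint from X such that all vertices in T have the same non-empty neighborhood in G. If |T| > f(k), then for every vertex z ∈ T and every integer h ≥ 0, the graph G admits an obstacle representation with at most h obstacles if and only if the graph G − z obtained from G by deleting the vertex z admits an obstacle representation with at most h obstacles. -/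
open scoped Classical

noncomputable section

/-! ### Polygons inscribed in a parabola -/

namespace ObstaclePruning

/-- A simple polygon is contained in the convex hull of its vertices. -/
lemma toSet_subset_convexHull (P : SimplePolygon) :
    P.toSet ⊆ convexHull ℝ (Set.range P.verts) := by
  have : NeZero P.k := ⟨by have := P.three_le; omega⟩
  have hbd : P.boundary ⊆ convexHull ℝ (Set.range P.verts) :=
    Set.iUnion_subset fun i => (convex_convexHull ℝ _).segment_subset
      (subset_convexHull ℝ _ ⟨i, rfl⟩) (subset_convexHull ℝ _ ⟨i + 1, rfl⟩)
  rintro x (hx | ⟨-, hx⟩)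
  · exact hbd hx
  by_contra hxh
  have hclosed : IsClosed (convexHull ℝ (Set.range P.verts)) :=
    (Set.finite_range P.verts).isClosed_convexHull ℝ
  obtain ⟨g, c, hg, hgx⟩ :=
    geometric_hahn_banach_closed_point (convex_convexHull ℝ _) hclosed hxh
  have hsub : {y | c < g y} ⊆ P.boundaryᶜ := fun y hy hyb => by
    have := hg y (hbd hyb)
    simp only [Set.mem_ofPred_eq] at hy
    linarith
  have hconn : IsPreconnected {y | c < g y} :=
    (convex_halfSpace_gt g.isLinear c).isPreconnected
  have hbdd := hx.subset (hconn.subset_connectedComponentIn (x := x) hgx hsub)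
  obtain ⟨C, hC⟩ := (g.lipschitz.isBounded_image hbdd).subset_closedBall 0
  obtain ⟨y₀, hy₀⟩ := (Set.range_nonempty P.verts)
  have hy₀c := hg y₀ (subset_convexHull ℝ _ hy₀)
  have hd : 0 < g (x - y₀) := by rw [map_sub]; linarith
  have hmem : g (x + (|C| / g (x - y₀)) • (x - y₀) + (1 / g (x - y₀) * (|c| + |g x|)) • (x - y₀)
      + (1 / g (x - y₀)) • (x - y₀)) ∈ g '' {y | c < g y} := by
    refine ⟨_, ?_, rfl⟩
    simp only [Set.mem_ofPred_eq, map_add, map_smul, smul_eq_mul]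
    have h1 : 0 ≤ |C| / g (x - y₀) * g (x - y₀) := by positivity
    have h2 : 0 ≤ 1 / g (x - y₀) * (|c| + |g x|) * g (x - y₀) := by positivity
    have h3 : 0 ≤ 1 / g (x - y₀) * g (x - y₀) := by positivity
    linarith
  have := hC hmem
  simp only [Metric.mem_closedBall, dist_zero_right, Real.norm_eq_abs, map_add, map_smul,
    smul_eq_mul] at this
  have h1 : |C| / g (x - y₀) * g (x - y₀) = |C| := by field_simp
  have h2 : 1 / g (x - y₀) * (|c| + |g x|) * g (x - y₀) = |c| + |g x| := by field_simp
  have h3 : 1 / g (x - y₀) * g (x - y₀) = 1 := by field_simp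
  rw [h1, h2, h3] at this
  have h4 := (le_abs_self _).trans this
  have h5 := neg_abs_le (g x)
  have h6 := abs_nonneg c
  have h7 := le_abs_self C
  linarith

/-- The point with parameter `s` on the downward parabola with apex `p`. -/
def parabolaPoint (p : ℝ × ℝ) (s : ℝ) : ℝ × ℝ := (p.1 + s, p.2 - s ^ 2)

lemma mem_segment_parabolaPoint {p x : ℝ × ℝ} {a b : ℝ} (hab : a < b) :
    x ∈ segment ℝ (parabolaPoint p a) (parabolaPoint p b) ↔
      a ≤ x.1 - p.1 ∧ x.1 - p.1 ≤ b ∧ x.2 - p.2 = -(a + b) * (x.1 - p.1) + a * b := by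
  constructor
  · rintro ⟨s, t, hs, ht, hst, rfl⟩
    obtain rfl : s = 1 - t := by linarith
    simp only [parabolaPoint, Prod.fst_add, Prod.smul_fst, Prod.snd_add, Prod.smul_snd,
      smul_eq_mul]
    refine ⟨?_, ?_, by ring⟩
    · nlinarith
    · nlinarith
  · rintro ⟨h1, h2, h3⟩
    have hd : 0 < b - a := by linarith
    refine ⟨(b - (x.1 - p.1)) / (b - a), ((x.1 - p.1) - a) / (b - a),
      div_nonneg (by linarith) hd.le, div_nonneg (by linarith) hd.le, ?_, ?_⟩
    · field_simp
      ring
    · ext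
      · simp only [parabolaPoint, Prod.fst_add, Prod.smul_fst, smul_eq_mul]
        field_simp
        ring
      · have : x.2 = p.2 + (-(a + b) * (x.1 - p.1) + a * b) := by linarith
        simp only [parabolaPoint, Prod.snd_add, Prod.smul_snd, smul_eq_mul]
        rw [this]
        field_simp
        ring

/-- Two chords of a parabola whose parameters interleave cross. -/
lemma chords_inter_nonempty (p : ℝ × ℝ) {a b c d : ℝ} (hac : a < c) (hcb : c < b) (hbd : b < d) :
    (segment ℝ (parabolaPoint p c) (parabolaPoint p d) ∩
      segment ℝ (parabolaPoint p a) (parabolaPoint p b)).Nonempty := by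
  have hD : 0 < c + d - a - b := by linarith
  have hc : c ≤ (c * d - a * b) / (c + d - a - b) := by
    rw [le_div_iff₀ hD]
    nlinarith [mul_pos (sub_pos.2 hac) (sub_pos.2 hcb)]
  have hb : (c * d - a * b) / (c + d - a - b) ≤ b := by
    rw [div_le_iff₀ hD]
    nlinarith [mul_pos (sub_pos.2 hcb) (sub_pos.2 hbd)]
  refine ⟨(p.1 + (c * d - a * b) / (c + d - a - b),
    p.2 + (-(a + b) * ((c * d - a * b) / (c + d - a - b)) + a * b)), ?_, ?_⟩
  · rw [mem_segment_parabolaPoint (hcb.trans hbd)]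
    refine ⟨by simpa using hc, by simp only [add_sub_cancel_left]; linarith, ?_⟩
    simp only [add_sub_cancel_left]
    field_simp
    ring
  · rw [mem_segment_parabolaPoint (hac.trans hcb)]
    refine ⟨by simp only [add_sub_cancel_left]; linarith, by simpa using hb, ?_⟩
    simp only [add_sub_cancel_left]

lemma parabolaPoint_eq {p x : ℝ × ℝ} {a b : ℝ} (hab : a < b)
    (hx : x ∈ segment ℝ (parabolaPoint p a) (parabolaPoint p b)) :
    (x.1 - p.1 = a → x = parabolaPoint p a) ∧ (x.1 - p.1 = b → x = parabolaPoint p b) := by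
  obtain ⟨-, -, h⟩ := (mem_segment_parabolaPoint hab).1 hx
  constructor <;> intro h' <;> rw [h'] at h <;> ext <;> simp only [parabolaPoint] <;> linarith

/-- A chord of a parabola meets a longer chord above the same interval only in a common
endpoint. -/
lemma nested_chords {p x : ℝ × ℝ} {a b c d : ℝ} (hac : a ≤ c) (hcd : c < d) (hdb : d ≤ b)
    (hne : a < c ∨ d < b)
    (hx : x ∈ segment ℝ (parabolaPoint p a) (parabolaPoint p b))
    (hx' : x ∈ segment ℝ (parabolaPoint p c) (parabolaPoint p d)) :
    (a = c ∧ x = parabolaPoint p a) ∨ (d = b ∧ x = parabolaPoint p b) := by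
  have hab : a < b := by linarith
  obtain ⟨-, -, h⟩ := (mem_segment_parabolaPoint hab).1 hx
  obtain ⟨h1, h2, h'⟩ := (mem_segment_parabolaPoint hcd).1 hx'
  obtain ⟨e1, e2⟩ := parabolaPoint_eq hab hx
  set X := x.1 - p.1
  have key : (X - a) * (b - X) = (X - c) * (d - X) := by linear_combination h - h'
  have key' : (c - a) * (b - X) + (X - c) * (b - d) = 0 := by linear_combination key
  have k1 : 0 ≤ (c - a) * (b - X) := mul_nonneg (by linarith) (by linarith)
  have k2 : 0 ≤ (X - c) * (b - d) := mul_nonneg (by linarith) (by linarith)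
  have k3 : (c - a) * (b - X) = 0 := by linarith
  have k4 : (X - c) * (b - d) = 0 := by linarith
  rcases mul_eq_zero.1 k3 with h3 | h3 <;> rcases mul_eq_zero.1 k4 with h4 | h4
  · exact Or.inl ⟨by linarith, e1 (by linarith)⟩
  · rcases hne with hne | hne <;> linarith
  · linarith
  · exact Or.inr ⟨by linarith, e2 (by linarith)⟩

lemma ZMod_succ_cases {n : ℕ} (hn : 3 ≤ n) (i : ZMod n) :
    (i.val + 1 < n ∧ (i + 1).val = i.val + 1) ∨ (i.val + 1 = n ∧ (i + 1).val = 0) := by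
  have : NeZero n := ⟨by omega⟩
  have : Fact (1 < n) := ⟨by omega⟩
  have hlt := ZMod.val_lt i
  have h := ZMod.val_add i 1
  rw [ZMod.val_one] at h
  rcases Nat.lt_or_ge (i.val + 1) n with h1 | h1
  · exact Or.inl ⟨h1, by rw [h, Nat.mod_eq_of_lt h1]⟩
  · have h2 : i.val + 1 = n := by omega
    exact Or.inr ⟨h2, by rw [h, h2, Nat.mod_self]⟩

/-- The convex polygon inscribed in a parabola, with vertices at given increasing parameters. -/
def parabolaPolygon (p : ℝ × ℝ) (n : ℕ) (hn : 3 ≤ n) (o : ℕ → ℝ) (ho : StrictMono o) :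
    SimplePolygon where
  k := n
  three_le := hn
  verts i := parabolaPoint p (o i.val)
  inj i j hij := by
    have : NeZero n := ⟨by omega⟩
    have h := congrArg Prod.fst hij
    simp only [parabolaPoint, add_right_inj] at h
    exact ZMod.val_injective n (ho.injective h)
  consec i := by
    refine Set.Subset.antisymm ?_ (Set.singleton_subset_iff.2
      ⟨right_mem_segment ℝ _ _, left_mem_segment ℝ _ _⟩)
    rintro x ⟨hx, hx'⟩
    have h2 : i + 2 = i + 1 + 1 := by ring
    rw [h2] at hx'
    rw [Set.mem_singleton_iff]
    rcases ZMod_succ_cases hn i with ⟨hi, hi'⟩ | ⟨hi, hi'⟩ <;>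
    rcases ZMod_succ_cases hn (i + 1) with ⟨hj, hj'⟩ | ⟨hj, hj'⟩ <;>
    rw [hj'] at hx' <;> rw [hi'] at hj hx hx' ⊢
    · have l1 := ho (Nat.lt_succ_self i.val)
      have l2 := ho (Nat.lt_succ_self (i.val + 1))
      obtain ⟨-, a2, -⟩ := (mem_segment_parabolaPoint l1).1 hx
      obtain ⟨b1, -, -⟩ := (mem_segment_parabolaPoint l2).1 hx'
      exact (parabolaPoint_eq l1 hx).2 (le_antisymm a2 b1)
    · have l1 := ho (Nat.lt_succ_self i.val)
      have l2 : o 0 < o i.val := ho (by omega)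
      rw [segment_symm] at hx'
      rcases nested_chords l2.le l1 le_rfl (Or.inl l2) hx' hx with h | h
      · linarith [h.1]
      · exact h.2
    · have l1 : o 0 < o (0 + 1) := ho (by omega)
      have l2 : o (0 + 1) < o i.val := ho (by omega)
      rw [segment_symm] at hx
      rcases nested_chords le_rfl l1 l2.le (Or.inr l2) hx hx' with h | h
      · exact h.2
      · linarith [h.1]
    · omega
  nonconsec i j hji h1 h2 := by
    have : NeZero n := ⟨by omega⟩
    have inj := ZMod.val_injective n
    have v0 : i.val ≠ j.val := fun h => hji (inj h).symm
    have v1 : j.val ≠ (i + 1).val := fun h => h1 (inj h)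
    have v2 : i.val ≠ (j + 1).val := fun h => h2 (inj h)
    have m : ∀ {a b : ℕ}, a < b → o a < o b := fun h => ho h
    rw [Set.disjoint_left]
    intro x hx hx'
    rcases ZMod_succ_cases hn i with ⟨hi, hi'⟩ | ⟨hi, hi'⟩ <;>
    rcases ZMod_succ_cases hn j with ⟨hj, hj'⟩ | ⟨hj, hj'⟩ <;>
    rw [hi'] at hx v1 <;> rw [hj'] at hx' v2
    · obtain ⟨a1, a2, -⟩ := (mem_segment_parabolaPoint (m (Nat.lt_succ_self i.val))).1 hx
      obtain ⟨b1, b2, -⟩ := (mem_segment_parabolaPoint (m (Nat.lt_succ_self j.val))).1 hx'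
      rcases lt_or_gt_of_ne v0 with h | h
      · have := m (show i.val + 1 < j.val by omega)
        linarith
      · have := m (show j.val + 1 < i.val by omega)
        linarith
    · rw [segment_symm] at hx'
      have l1 : o 0 < o i.val := m (by omega)
      have l2 : o (i.val + 1) < o j.val := m (by omega)
      rcases nested_chords l1.le (m (Nat.lt_succ_self i.val)) l2.le (Or.inl l1) hx' hx with h | h
      · linarith [h.1]
      · have := h.1
        simp only [Nat.succ_eq_add_one] at this
        linarith
    · rw [segment_symm] at hx
      have l1 : o 0 < o j.val := m (by omega)
      have l2 : o (j.val + 1) < o i.val := m (by omega)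
      rcases nested_chords l1.le (m (Nat.lt_succ_self j.val)) l2.le (Or.inl l1) hx hx' with h | h
      · linarith [h.1]
      · have := h.1
        simp only [Nat.succ_eq_add_one] at this
        linarith
    · omega

lemma segment_subset_parabolaPolygon (p : ℝ × ℝ) {n : ℕ} (hn : 3 ≤ n) {o : ℕ → ℝ}
    (ho : StrictMono o) {j : ℕ} (hj : j + 1 < n) :
    segment ℝ (parabolaPoint p (o j)) (parabolaPoint p (o (j + 1))) ⊆
      (parabolaPolygon p n hn o ho).toSet := by
  refine Set.Subset.trans ?_ Set.subset_union_left
  refine Set.Subset.trans (Eq.subset ?_) (Set.subset_iUnion (fun i : ZMod n =>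
    segment ℝ (parabolaPoint p (o i.val)) (parabolaPoint p (o (i + 1).val))) (j : ZMod n))
  have h1 : ((j : ZMod n)).val = j := ZMod.val_natCast_of_lt (by omega)
  have h2 : ((j : ZMod n) + 1).val = j + 1 := by
    rw [← Nat.cast_succ]
    exact ZMod.val_natCast_of_lt hj
  rw [h1, h2]

lemma parabolaPolygon_toSet_subset (p : ℝ × ℝ) {n : ℕ} (hn : 3 ≤ n) {o : ℕ → ℝ}
    (ho : StrictMono o) {s : Set (ℝ × ℝ)} (hs : Convex ℝ s)
    (h : ∀ j < n, parabolaPoint p (o j) ∈ s) : (parabolaPolygon p n hn o ho).toSet ⊆ s := by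
  have : NeZero n := ⟨by omega⟩
  refine (toSet_subset_convexHull _).trans (convexHull_min ?_ hs)
  rintro _ ⟨i, rfl⟩
  exact h _ (ZMod.val_lt (n := n) i)

/-! ### A robust placement of points -/

open Filter Topology Metric

/-- Twice the signed area of the triangle `a b c`. -/
def orient (a b c : ℝ × ℝ) : ℝ := (b.1 - a.1) * (c.2 - a.2) - (b.2 - a.2) * (c.1 - a.1)

lemma orient_eq_zero_of_mem_segment {u v x : ℝ × ℝ} (hx : x ∈ segment ℝ u v) :
    orient u v x = 0 := by
  obtain ⟨s, t, -, -, hst, rfl⟩ := hx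
  obtain rfl : s = 1 - t := by linarith
  simp only [orient, Prod.fst_add, Prod.smul_fst, Prod.snd_add, Prod.smul_snd, smul_eq_mul]
  ring

lemma not_collinear_of_orient_ne_zero {a b c : ℝ × ℝ} (h : orient a b c ≠ 0) :
    ¬ Collinear ℝ ({a, b, c} : Set (ℝ × ℝ)) := by
  intro hcol
  obtain ⟨d, hd⟩ := (collinear_iff_of_mem (p₀ := a) (by simp)).1 hcol
  obtain ⟨s, rfl⟩ := hd b (by simp)
  obtain ⟨t, rfl⟩ := hd c (by simp)
  apply h
  simp only [orient, vadd_eq_add, Prod.fst_add, Prod.smul_fst, Prod.snd_add, Prod.smul_snd,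
    smul_eq_mul]
  ring

lemma orient_rotate (a b c : ℝ × ℝ) : orient a b c = orient b c a := by
  simp only [orient]
  ring

/-- The height of `u` above the chord with parameters `s` and `t` of the parabola with apex `a`. -/
def chordHeight (a u : ℝ × ℝ) (s t : ℝ) : ℝ :=
  u.2 - a.2 + (s + t) * (u.1 - a.1) - s * t

lemma orient_parabolaPoint (a u : ℝ × ℝ) (s t : ℝ) :
    orient (parabolaPoint a s) (parabolaPoint a t) u = (t - s) * chordHeight a u s t := by
  simp only [orient, parabolaPoint, chordHeight]
  ring

lemma chordHeight_parabolaPoint (a : ℝ × ℝ) (s t w : ℝ) :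
    chordHeight a (parabolaPoint a w) s t = -((w - s) * (w - t)) := by
  simp only [parabolaPoint, chordHeight]
  ring

lemma convex_chordHeight_neg (a : ℝ × ℝ) (s t : ℝ) :
    Convex ℝ {u | chordHeight a u s t < 0} := by
  intro u hu v hv x y hx hy hxy
  obtain rfl : x = 1 - y := by linarith
  simp only [Set.mem_ofPred_eq] at hu hv ⊢
  have : chordHeight a ((1 - y) • u + y • v) s t =
      (1 - y) * chordHeight a u s t + y * chordHeight a v s t := by
    simp only [chordHeight, Prod.fst_add, Prod.smul_fst, Prod.snd_add, Prod.smul_snd, smul_eq_mul]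
    ring
  rw [this]
  rcases hx.eq_or_lt with h | h
  · rw [← h, show y = 1 by linarith]
    linarith
  · nlinarith

lemma convex_chordHeight_nonneg (a : ℝ × ℝ) (s t : ℝ) :
    Convex ℝ {u | 0 ≤ chordHeight a u s t} := by
  intro u hu v hv x y hx hy hxy
  obtain rfl : x = 1 - y := by linarith
  simp only [Set.mem_ofPred_eq] at hu hv ⊢
  have : chordHeight a ((1 - y) • u + y • v) s t =
      (1 - y) * chordHeight a u s t + y * chordHeight a v s t := by
    simp only [chordHeight, Prod.fst_add, Prod.smul_fst, Prod.snd_add, Prod.smul_snd, smul_eq_mul]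
    ring
  rw [this]
  positivity

/-- The centers around which the vertex classes are placed. -/
def center (i : ℕ) : ℝ × ℝ := ((i : ℝ) ^ 2, (i : ℝ))

/-- The affine function vanishing on the line through the centers `a` and `b`. -/
def lineFun (a b : ℕ) (x : ℝ × ℝ) : ℝ := x.1 - (a + b) * x.2 + a * b

lemma orient_center (a b : ℕ) (x : ℝ × ℝ) :
    orient (center a) (center b) x = -((b - a) * lineFun a b x) := by
  simp only [orient, center, lineFun]
  ring

lemma lineFun_center (a b i : ℕ) : lineFun a b (center i) = (i - a) * (i - b) := by
  simp only [center, lineFun]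
  ring

lemma lineFun_combo (a b i j : ℕ) (τ : ℝ) :
    lineFun a b ((1 - τ) • center i + τ • center j) =
      (1 - τ) * lineFun a b (center i) + τ * lineFun a b (center j) := by
  simp only [lineFun, Prod.fst_add, Prod.smul_fst, Prod.snd_add, Prod.smul_snd, smul_eq_mul]
  ring

/-- On the segment between two centers there is a point lying on no other line spanned by
centers. -/
lemma exists_private_point (m i j : ℕ) (hij : i < j) : ∃ x : ℝ × ℝ,
    (∃ τ : ℝ, 0 < τ ∧ τ < 1 ∧ x = (1 - τ) • center i + τ • center j) ∧
    ∀ a < m, ∀ b < m, ¬ (a = i ∧ b = j) → ¬ (a = j ∧ b = i) → lineFun a b x ≠ 0 := by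
  let bad : ℕ × ℕ → Set ℝ := fun q => {τ | ¬ (q.1 = i ∧ q.2 = j) ∧ ¬ (q.1 = j ∧ q.2 = i) ∧
    lineFun q.1 q.2 ((1 - τ) • center i + τ • center j) = 0}
  have hbad : ∀ q, (bad q).Finite := by
    rintro ⟨a, b⟩
    refine Set.Subsingleton.finite ?_
    rintro τ ⟨h1, h2, h3⟩ τ' ⟨-, -, h3'⟩
    by_contra hne
    simp only [lineFun_combo] at h1 h2 h3 h3'
    set A := lineFun a b (center i) with hA
    set B := lineFun a b (center j) with hB
    have hsub : τ - τ' ≠ 0 := sub_ne_zero.2 hne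
    have hAB : (τ - τ') * (B - A) = 0 := by linear_combination h3 - h3'
    have hBA : B = A := by
      rcases mul_eq_zero.1 hAB with h | h
      · exact absurd h hsub
      · linarith
    have hA0 : A = 0 := by rw [hBA] at h3; linarith
    have hB0 : B = 0 := by rw [hBA, hA0]
    rw [hA, lineFun_center, mul_eq_zero, sub_eq_zero, sub_eq_zero] at hA0
    rw [hB, lineFun_center, mul_eq_zero, sub_eq_zero, sub_eq_zero] at hB0
    norm_cast at hA0 hB0
    omega
  have hfin : (⋃ q ∈ (Finset.range m ×ˢ Finset.range m : Finset (ℕ × ℕ)), bad q).Finite :=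
    Set.Finite.biUnion (Finset.finite_toSet _) fun q _ => hbad q
  obtain ⟨τ, hτ, hτ'⟩ := (Set.Ioo_infinite (zero_lt_one (α := ℝ))).exists_notMem_finite hfin
  refine ⟨_, ⟨τ, hτ.1, hτ.2, rfl⟩, fun a ha b hb h1 h2 h3 => hτ' ?_⟩
  exact Set.mem_biUnion (x := (a, b)) (by simp [ha, hb]) ⟨h1, h2, h3⟩

lemma eventually_forall_ball {E : Type*} [PseudoMetricSpace E] {x : E} {P : E → Prop}
    (h : ∀ᶠ y in 𝓝 x, P y) : ∀ᶠ r in 𝓝[>] (0 : ℝ), ∀ y ∈ ball x r, P y := by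
  obtain ⟨ε, hε, hP⟩ := Metric.eventually_nhds_iff_ball.1 h
  filter_upwards [Ioo_mem_nhdsGT hε] with r hr y hy
  exact hP y (ball_subset_ball hr.2.le hy)

lemma eventually_forall_ball₂ {E F : Type*} [PseudoMetricSpace E] [PseudoMetricSpace F]
    {x : E} {y : F} {P : E → F → Prop} (h : ∀ᶠ q in 𝓝 (x, y), P q.1 q.2) :
    ∀ᶠ r in 𝓝[>] (0 : ℝ), ∀ u ∈ ball x r, ∀ v ∈ ball y r, P u v := by
  filter_upwards [eventually_forall_ball h] with r hr u hu v hv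
  exact hr (u, v) (by rw [← ball_prod_same]; exact ⟨hu, hv⟩)

lemma eventually_forall_ball₃ {E F H : Type*} [PseudoMetricSpace E] [PseudoMetricSpace F]
    [PseudoMetricSpace H] {x : E} {y : F} {z : H} {P : E → F → H → Prop}
    (h : ∀ᶠ q in 𝓝 (x, y, z), P q.1 q.2.1 q.2.2) :
    ∀ᶠ r in 𝓝[>] (0 : ℝ), ∀ u ∈ ball x r, ∀ v ∈ ball y r, ∀ w ∈ ball z r, P u v w := by
  filter_upwards [eventually_forall_ball h] with r hr u hu v hv w hw
  exact hr (u, v, w) (by rw [← ball_prod_same, ← ball_prod_same]; exact ⟨hu, hv, hw⟩)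

lemma eventually_orient_ne_zero {x y z : ℝ × ℝ} (h : orient x y z ≠ 0) :
    ∀ᶠ r in 𝓝[>] (0 : ℝ), ∀ u ∈ ball x r, ∀ v ∈ ball y r, ∀ w ∈ ball z r, orient u v w ≠ 0 := by
  refine eventually_forall_ball₃ ?_
  have hc : Continuous fun q : (ℝ × ℝ) × (ℝ × ℝ) × (ℝ × ℝ) => orient q.1 q.2.1 q.2.2 := by
    unfold orient
    fun_prop
  exact hc.continuousAt.eventually_ne h

lemma eventually_disjoint_ball {x y : ℝ × ℝ} (h : x ≠ y) :
    ∀ᶠ r in 𝓝[>] (0 : ℝ), Disjoint (ball x r) (ball y r) := by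
  filter_upwards [Ioo_mem_nhdsGT (half_pos (dist_pos.2 h))] with r hr
  exact ball_disjoint_ball (by linarith [hr.2])

lemma eventually_chordHeight {a b : ℕ} (h : a ≠ b) :
    ∀ᶠ r in 𝓝[>] (0 : ℝ), ∀ u ∈ ball (center b) r, ∀ s ∈ ball (0 : ℝ) r, ∀ t ∈ ball (0 : ℝ) r,
      chordHeight (center a) u s t ≠ 0 ∧ (a < b → 0 < chordHeight (center a) u s t) := by
  refine eventually_forall_ball₃
    (P := fun u s t => chordHeight (center a) u s t ≠ 0 ∧
      (a < b → 0 < chordHeight (center a) u s t)) ?_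
  have hc : Continuous fun q : (ℝ × ℝ) × ℝ × ℝ => chordHeight (center a) q.1 q.2.1 q.2.2 := by
    unfold chordHeight
    fun_prop
  have h0 : chordHeight (center a) (center b) 0 0 = b - a := by simp [chordHeight, center]
  refine Filter.Eventually.and (hc.continuousAt.eventually_ne ?_) ?_
  · rw [h0, sub_ne_zero]
    exact_mod_cast h.symm
  · by_cases hab : a < b
    · refine (hc.continuousAt.eventually_const_lt ?_).mono fun q hq _ => hq
      simp only [h0, sub_pos]
      exact_mod_cast hab
    · exact Filter.Eventually.of_forall fun q h => absurd h hab

/-- A short horizontal segment through an inner point of the segment between two centers meets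
all segments whose endpoints are close to these centers. -/
lemma eventually_crossing {i j : ℕ} (hij : i < j) {x : ℝ × ℝ} {τ δ : ℝ} (hδ : 0 < δ)
    (h0 : 0 < τ) (h1 : τ < 1) (hx : x = (1 - τ) • center i + τ • center j) :
    ∀ᶠ r in 𝓝[>] (0 : ℝ), ∀ u ∈ ball (center i) r, ∀ v ∈ ball (center j) r,
      ∃ y ∈ segment ℝ u v, |y.1 - x.1| ≤ δ ∧ y.2 = x.2 := by
  refine eventually_forall_ball₂ (P := fun u v : ℝ × ℝ => ∃ y ∈ segment ℝ u v,
    |y.1 - x.1| ≤ δ ∧ y.2 = x.2) ?_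
  have hij' : (0 : ℝ) < j - i := sub_pos.2 (by exact_mod_cast hij)
  have hx1 : x.1 = (1 - τ) * i ^ 2 + τ * j ^ 2 := by simp [hx, center]
  have hx2 : x.2 = (1 - τ) * i + τ * j := by simp [hx, center]
  let l : (ℝ × ℝ) × (ℝ × ℝ) → ℝ := fun q => (x.2 - q.1.2) / (q.2.2 - q.1.2)
  have hne : (center i, center j).2.2 - (center i, center j).1.2 ≠ 0 := by
    simpa [center] using hij'.ne'
  have hl : ContinuousAt l (center i, center j) :=
    ContinuousAt.div (by fun_prop) (by fun_prop) hne
  have hl0 : l (center i, center j) = τ := by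
    simp only [l, center, hx2]
    field_simp
    ring
  have hg : ContinuousAt (fun q : (ℝ × ℝ) × (ℝ × ℝ) =>
      |(1 - l q) * q.1.1 + l q * q.2.1 - x.1|) (center i, center j) := by
    fun_prop
  have hg0 : |(1 - l (center i, center j)) * (center i).1 + l (center i, center j) * (center j).1
      - x.1| < δ := by
    rw [hl0, hx1]
    simpa [center] using hδ
  have hd : ContinuousAt (fun q : (ℝ × ℝ) × (ℝ × ℝ) => q.2.2 - q.1.2) (center i, center j) := by
    fun_prop
  filter_upwards [hg.eventually_lt_const hg0, hl.eventually_const_lt (hl0.symm ▸ h0),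
    hl.eventually_lt_const (hl0.symm ▸ h1), hd.eventually_ne hne] with q hq hq0 hq1 hqd
  refine ⟨(1 - l q) • q.1 + l q • q.2, ⟨1 - l q, l q, by linarith, hq0.le, by ring, rfl⟩, ?_, ?_⟩
  · simpa using hq.le
  · simp only [l, Prod.snd_add, Prod.smul_snd, smul_eq_mul]
    field_simp
    ring

/-! ### Representations with few obstacles -/

/-- A placement together with obstacles indexed by a finite type yields an obstacle
representation. -/
lemma exists_obstacleRep_of_family {V ι : Type*} [Fintype ι] {G : SimpleGraph V}
    (pos : V → ℝ × ℝ) (posInj : Function.Injective pos)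
    (genPos : ∀ u v w : V, u ≠ v → u ≠ w → v ≠ w →
      ¬ Collinear ℝ ({pos u, pos v, pos w} : Set (ℝ × ℝ)))
    (obs : ι → SimplePolygon)
    (disj : ∀ i j, i ≠ j → Disjoint (obs i).toSet (obs j).toSet)
    (edges_clear : ∀ u v : V, G.Adj u v → ∀ i,
      Disjoint (segment ℝ (pos u) (pos v)) (obs i).toSet)
    (nonedges_blocked : ∀ u v : V, u ≠ v → ¬ G.Adj u v →
      ∃ i, (segment ℝ (pos u) (pos v) ∩ (obs i).toSet).Nonempty) :
    ∃ R : ObstacleRep G, R.numObs = Fintype.card ι := by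
  let e := Fintype.equivFin ι
  refine ⟨⟨pos, posInj, genPos, Fintype.card ι, fun i => obs (e.symm i),
    fun i j hij => disj _ _ (e.symm.injective.ne hij),
    fun u v h i => edges_clear u v h _, fun u v huv h => ?_⟩, rfl⟩
  obtain ⟨i, hi⟩ := nonedges_blocked u v huv h
  exact ⟨e i, by simpa using hi⟩

lemma parabolaPoint_mem_ball {p : ℝ × ℝ} {r s : ℝ} (hr : r ≤ 1) (hs : |s| < r) :
    parabolaPoint p s ∈ ball p r := by
  have hs2 : s ^ 2 < r := by
    rw [← sq_abs]
    nlinarith [abs_nonneg s]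
  rw [← Prod.mk.eta (p := p), ← ball_prod_same]
  refine ⟨by simpa [parabolaPoint] using hs, ?_⟩
  simp only [parabolaPoint, mem_ball, Real.dist_eq, sub_sub_cancel_left, abs_neg]
  rwa [abs_of_nonneg (sq_nonneg s)]

/-- If the vertices of a graph are split into `m` linearly ordered classes of twins such that all
neighbors of vertices in classes with at least two elements lie in later classes, then the graph
has an obstacle representation whose number of obstacles is bounded in terms of `m`. -/
theorem exists_obstacleRep_of_twin_classes {V : Type*} [Fintype V] (G : SimpleGraph V) (m : ℕ)
    (c : V → Fin m) (D : Set (Fin m))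
    (twin : ∀ u v w, c u = c v → (G.Adj u w ↔ G.Adj v w))
    (later : ∀ u v, c u ∈ D → G.Adj u v → c u < c v)
    (single : ∀ u v, c u = c v → u ≠ v → c u ∈ D) :
    ∃ R : ObstacleRep G, R.numObs ≤ m * m + m := by
  choose μ hμ hμ' using fun e : {e : Fin m × Fin m // e.1 < e.2} =>
    exists_private_point m e.1.1 e.1.2 e.2
  have hline : ∀ e : {e : Fin m × Fin m // e.1 < e.2}, ∀ a b : Fin m,
      (a, b) ≠ e.1 → (b, a) ≠ e.1 → lineFun a b (μ e) ≠ 0 := by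
    intro e a b h1 h2
    refine hμ' e a a.2 b b.2 (fun h => h1 ?_) (fun h => h2 ?_)
    · exact Prod.ext (Fin.ext h.1) (Fin.ext h.2)
    · exact Prod.ext (Fin.ext h.2) (Fin.ext h.1)
  have hline0 : ∀ e : {e : Fin m × Fin m // e.1 < e.2}, lineFun e.1.1 e.1.2 (μ e) = 0 := by
    intro e
    obtain ⟨τ, -, -, h⟩ := hμ e
    rw [h, lineFun_combo, lineFun_center, lineFun_center]
    ring
  have hcast : ∀ {a b : Fin m}, a ≠ b → ((a : ℕ) : ℝ) - ((b : ℕ) : ℝ) ≠ 0 := by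
    intro a b h
    rw [sub_ne_zero]
    exact_mod_cast Fin.val_injective.ne h
  -- a radius for which all relevant strict conditions persist
  have E1 : ∀ᶠ r in 𝓝[>] (0 : ℝ), ∀ a b : Fin m, a ≠ b →
      Disjoint (ball (center a) r) (ball (center b) r) := by
    refine eventually_all.2 fun a => eventually_all.2 fun b => ?_
    by_cases h : a = b
    · simp [h]
    · refine (eventually_disjoint_ball fun hab => hcast h ?_).mono fun r hr _ => hr
      rw [sub_eq_zero]
      exact congrArg Prod.snd hab
  have E2 : ∀ᶠ r in 𝓝[>] (0 : ℝ), ∀ (a : Fin m) (e : {e : Fin m × Fin m // e.1 < e.2}),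
      Disjoint (ball (center a) r) (ball (μ e) r) := by
    refine eventually_all.2 fun a => eventually_all.2 fun e => eventually_disjoint_ball fun h => ?_
    have hne : (a, a) ≠ e.1 := fun h => absurd e.2 (by rw [← h]; exact lt_irrefl _)
    refine hline e a a hne hne ?_
    rw [← h, lineFun_center]
    ring
  have E3 : ∀ᶠ r in 𝓝[>] (0 : ℝ), ∀ e e' : {e : Fin m × Fin m // e.1 < e.2}, e ≠ e' →
      Disjoint (ball (μ e) r) (ball (μ e') r) := by
    refine eventually_all.2 fun e => eventually_all.2 fun e' => ?_
    by_cases h : e = e'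
    · simp [h]
    · refine (eventually_disjoint_ball fun hab => ?_).mono fun r hr _ => hr
      refine hline e' e.1.1 e.1.2 (fun h' => h (Subtype.ext h')) (fun h' => ?_)
        (by rw [← hab, hline0])
      have h1 := e.2
      have h2 := e'.2
      rw [← h'] at h2
      exact lt_asymm h1 h2
  have E4 : ∀ᶠ r in 𝓝[>] (0 : ℝ), ∀ a b d : Fin m, a ≠ b → a ≠ d → b ≠ d →
      ∀ u ∈ ball (center a) r, ∀ v ∈ ball (center b) r, ∀ w ∈ ball (center d) r,
        orient u v w ≠ 0 := by
    refine eventually_all.2 fun a => eventually_all.2 fun b => eventually_all.2 fun d => ?_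
    by_cases h : a ≠ b ∧ a ≠ d ∧ b ≠ d
    · refine (eventually_orient_ne_zero ?_).mono fun r hr _ _ _ => hr
      rw [orient_center, lineFun_center]
      exact neg_ne_zero.2 (mul_ne_zero (hcast h.1.symm)
        (mul_ne_zero (hcast h.2.1.symm) (hcast h.2.2.symm)))
    · exact Eventually.of_forall fun r h1 h2 h3 => absurd ⟨h1, h2, h3⟩ h
  have E5 : ∀ᶠ r in 𝓝[>] (0 : ℝ), ∀ (a b : Fin m) (e : {e : Fin m × Fin m // e.1 < e.2}),
      a ≠ b → (a, b) ≠ e.1 → (b, a) ≠ e.1 →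
      ∀ u ∈ ball (center a) r, ∀ v ∈ ball (center b) r, ∀ w ∈ ball (μ e) r,
        orient u v w ≠ 0 := by
    refine eventually_all.2 fun a => eventually_all.2 fun b => eventually_all.2 fun e => ?_
    by_cases h : a ≠ b ∧ (a, b) ≠ e.1 ∧ (b, a) ≠ e.1
    · refine (eventually_orient_ne_zero ?_).mono fun r hr _ _ _ => hr
      rw [orient_center]
      exact neg_ne_zero.2 (mul_ne_zero (hcast h.1.symm) (hline e a b h.2.1 h.2.2))
    · exact Eventually.of_forall fun r h1 h2 h3 => absurd ⟨h1, h2, h3⟩ h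
  have E6 : ∀ᶠ r in 𝓝[>] (0 : ℝ), ∀ a b : Fin m, a ≠ b →
      ∀ u ∈ ball (center b) r, ∀ s ∈ ball (0 : ℝ) r, ∀ t ∈ ball (0 : ℝ) r,
        chordHeight (center a) u s t ≠ 0 ∧ (a < b → 0 < chordHeight (center a) u s t) := by
    refine eventually_all.2 fun a => eventually_all.2 fun b => ?_
    by_cases h : a = b
    · simp [h]
    · exact (eventually_chordHeight (Fin.val_injective.ne h)).mono fun r hr _ => hr
  have E0 : ∀ t : ℝ, 0 < t → ∀ᶠ r in 𝓝[>] (0 : ℝ), 0 < r ∧ r < t := fun t ht =>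
    Ioo_mem_nhdsGT ht
  obtain ⟨r, ⟨hr0, hr1⟩, F1, F2, F3, F4, F5, F6⟩ :=
    ((E0 1 one_pos).and (E1.and (E2.and (E3.and (E4.and (E5.and E6)))))).exists
  -- a smaller radius for which the class pairs remain blocked
  set δ : ℝ := r / 8 with hδ
  have hδ0 : 0 < δ := by positivity
  have E7 : ∀ᶠ ρ in 𝓝[>] (0 : ℝ), ∀ e : {e : Fin m × Fin m // e.1 < e.2},
      ∀ u ∈ ball (center e.1.1) ρ, ∀ v ∈ ball (center e.1.2) ρ,
        ∃ y ∈ segment ℝ u v, |y.1 - (μ e).1| ≤ δ ∧ y.2 = (μ e).2 := by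
    refine eventually_all.2 fun e => ?_
    obtain ⟨τ, h0, h1, h⟩ := hμ e
    exact eventually_crossing e.2 hδ0 h0 h1 h
  obtain ⟨ρ, ⟨hρ0, hρr⟩, F7⟩ := ((E0 r hr0).and E7).exists
  set N := Fintype.card V with hN
  set ε : ℝ := ρ / (N + 4) with hε
  have hε0 : 0 < ε := by positivity
  have hε1 : ε * (N + 4) = ρ := by
    rw [hε]
    field_simp
  have hsmall : ∀ x : ℝ, 0 ≤ x → x < N + 4 → |ε * x| < ρ := by
    intro x h0 h1
    rw [abs_of_nonneg (by positivity), ← hε1]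
    gcongr
  let σ : V → ℕ := fun v => Fintype.equivFin V v
  have hσ : Function.Injective σ := Fin.val_injective.comp (Fintype.equivFin V).injective
  have hσN : ∀ v, σ v < N := fun v => (Fintype.equivFin V v).2
  let s : V → ℝ := fun v => ε * (σ v + 1 / 2)
  have hs : Function.Injective s := by
    intro u v h
    have := mul_left_cancel₀ hε0.ne' h
    exact hσ (by exact_mod_cast add_right_cancel this)
  have hsρ : ∀ v, |s v| < ρ := by
    intro v
    have : ((σ v : ℕ) : ℝ) < N := by exact_mod_cast hσN v
    exact hsmall _ (by positivity) (by linarith)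
  have hs_ball : ∀ v, s v ∈ ball (0 : ℝ) r := fun v => by
    simpa using (hsρ v).trans hρr
  let pos : V → ℝ × ℝ := fun v => parabolaPoint (center (c v)) (s v)
  have hposρ : ∀ v, pos v ∈ ball (center (c v)) ρ := fun v =>
    parabolaPoint_mem_ball (hρr.trans hr1).le (hsρ v)
  have hpos : ∀ v, pos v ∈ ball (center (c v)) r := fun v =>
    ball_subset_ball hρr.le (hposρ v)
  have adj_ne : ∀ u v, G.Adj u v → c u ≠ c v := fun u v h hc =>
    G.irrefl ((twin u v v hc).1 h)
  -- the obstacles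
  have hoK : StrictMono fun j : ℕ => ε * (j : ℝ) := fun i j hij => by
    have : (i : ℝ) < j := by exact_mod_cast hij
    exact mul_lt_mul_of_pos_left this hε0
  have hoB : StrictMono fun j : ℕ => δ * (2 * (j : ℝ) - 1) := fun i j hij => by
    have : (i : ℝ) < j := by exact_mod_cast hij
    exact mul_lt_mul_of_pos_left (by linarith) hδ0
  let K : Fin m → SimplePolygon := fun q =>
    parabolaPolygon (center q) (N + 3) (by omega) _ hoK
  let B : {e : Fin m × Fin m // e.1 < e.2} → SimplePolygon := fun e =>
    parabolaPolygon ((μ e).1, (μ e).2 + δ ^ 2) 3 le_rfl _ hoB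
  have hK : ∀ q, (K q).toSet ⊆ ball (center q) r := by
    intro q
    refine parabolaPolygon_toSet_subset _ _ _ (convex_ball _ _) fun j hj => ?_
    refine parabolaPoint_mem_ball hr1.le ((hsmall _ (by positivity) ?_).trans hρr)
    have : ((j : ℕ) : ℝ) < (N + 3 : ℕ) := by exact_mod_cast hj
    push_cast at this
    linarith
  have hB : ∀ e, (B e).toSet ⊆ ball (μ e) r := by
    intro e
    refine parabolaPolygon_toSet_subset _ _ _ (convex_ball _ _) fun j hj => ?_
    rw [← Prod.mk.eta (p := μ e), ← ball_prod_same]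
    simp only [parabolaPoint, Set.mem_prod, mem_ball, Real.dist_eq, abs_lt]
    have hrr : r * r < r := by nlinarith
    interval_cases j <;> push_cast <;> refine ⟨⟨?_, ?_⟩, ?_, ?_⟩ <;> nlinarith
  let ι := {e : {e : Fin m × Fin m // e.1 < e.2} //
    ∀ u v, c u = e.1.1 → c v = e.1.2 → ¬ G.Adj u v} ⊕ D
  let obs : ι → SimplePolygon := Sum.elim (fun e => B e.1) fun q => K q.1
  have hcard : Fintype.card ι ≤ m * m + m := by
    rw [Fintype.card_sum]
    refine Nat.add_le_add ?_ ?_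
    · refine (Fintype.card_subtype_le _).trans ((Fintype.card_subtype_le _).trans ?_)
      simp
    · exact (Fintype.card_subtype_le _).trans (by simp)
  suffices ∃ R : ObstacleRep G, R.numObs = Fintype.card ι from
    this.imp fun R hR => hR.le.trans hcard
  refine exists_obstacleRep_of_family (ι := ι) pos ?_ ?_ obs ?_ ?_ ?_
  · intro u v h
    have hc : c u = c v := by
      by_contra hc
      exact Set.disjoint_left.1 (F1 _ _ hc) (hpos u) (h ▸ hpos v)
    simp only [pos, hc, parabolaPoint, Prod.mk.injEq, add_right_inj] at h
    exact hs h.1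
  · have two : ∀ u v w, u ≠ v → c u = c v → c u ≠ c w → orient (pos u) (pos v) (pos w) ≠ 0 := by
      intro u v w huv hc hc'
      simp only [pos, ← hc, orient_parabolaPoint]
      exact mul_ne_zero (sub_ne_zero.2 (hs.ne huv.symm))
        (F6 _ _ hc' _ (hpos w) _ (hs_ball u) _ (hs_ball v)).1
    intro u v w huv huw hvw
    apply not_collinear_of_orient_ne_zero
    by_cases h1 : c u = c v
    · by_cases h2 : c u = c w
      · simp only [pos, ← h1, ← h2, orient_parabolaPoint, chordHeight_parabolaPoint]
        exact mul_ne_zero (sub_ne_zero.2 (hs.ne huv.symm)) (neg_ne_zero.2 (mul_ne_zero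
          (sub_ne_zero.2 (hs.ne huw.symm)) (sub_ne_zero.2 (hs.ne hvw.symm))))
      · exact two u v w huv h1 h2
    · by_cases h2 : c v = c w
      · rw [orient_rotate]
        exact two v w u hvw h2 (Ne.symm h1)
      · by_cases h3 : c w = c u
        · rw [orient_rotate, orient_rotate]
          exact two w u v huw.symm h3 (Ne.symm h2)
        · exact F4 _ _ _ h1 (Ne.symm h3) h2 _ (hpos u) _ (hpos v) _ (hpos w)
  · rintro (e | q) (e' | q') h
    · exact (F3 e.1 e'.1 fun h' => h (by rw [Subtype.ext h'])).mono (hB _) (hB _)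
    · exact (F2 q'.1 e.1).symm.mono (hB _) (hK _)
    · exact (F2 q.1 e'.1).mono (hK _) (hB _)
    · exact (F1 q.1 q'.1 fun h' => h (by rw [Subtype.ext h'])).mono (hK _) (hK _)
  · have tangent : ∀ u v, G.Adj u v → c u ∈ D →
        Disjoint (segment ℝ (pos u) (pos v)) (K (c u)).toSet := by
      intro u v h hu
      have hseg : segment ℝ (pos u) (pos v) ⊆
          {x | 0 ≤ chordHeight (center (c u)) x (s u) (s u)} := by
        refine (convex_chordHeight_nonneg _ _ _).segment_subset ?_ ?_
        · simp [pos, chordHeight_parabolaPoint]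
        · exact ((F6 _ _ (adj_ne u v h) _ (hpos v) _ (hs_ball u) _ (hs_ball u)).2
            (later u v hu h)).le
      have hKneg : (K (c u)).toSet ⊆ {x | chordHeight (center (c u)) x (s u) (s u) < 0} := by
        refine parabolaPolygon_toSet_subset _ _ _ (convex_chordHeight_neg _ _ _) fun j _ => ?_
        simp only [Set.mem_ofPred_eq, chordHeight_parabolaPoint, neg_lt_zero, ← sq]
        refine sq_pos_of_ne_zero (sub_ne_zero.2 fun h => ?_)
        have h2 := mul_left_cancel₀ hε0.ne' h
        have h3 : (2 * j : ℝ) = 2 * σ u + 1 := by linarith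
        norm_cast at h3
        omega
      refine Set.disjoint_left.2 fun x hx hx' => ?_
      have h1 := hseg hx
      have h2 := hKneg hx'
      simp only [Set.mem_ofPred_eq] at h1 h2
      linarith
    rintro u v h (e | q)
    · refine Set.disjoint_left.2 fun x hx hx' => ?_
      refine F5 (c u) (c v) e.1 (adj_ne u v h) (fun he => ?_) (fun he => ?_) _ (hpos u) _ (hpos v)
        x (hB _ hx') (orient_eq_zero_of_mem_segment hx)
      · exact e.2 u v (congrArg Prod.fst he) (congrArg Prod.snd he) h
      · exact e.2 v u (congrArg Prod.fst he) (congrArg Prod.snd he) h.symm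
    · obtain ⟨q, hq⟩ := q
      by_cases hqu : c u = q
      · subst hqu
        exact tangent u v h hq
      by_cases hqv : c v = q
      · subst hqv
        rw [segment_symm]
        exact tangent v u h.symm hq
      refine Set.disjoint_left.2 fun x hx hx' => ?_
      exact F4 _ _ _ (adj_ne u v h) hqu hqv _ (hpos u) _ (hpos v) x (hK _ hx')
        (orient_eq_zero_of_mem_segment hx)
  · have same : ∀ u v, c u = c v → σ u < σ v →
        (segment ℝ (pos u) (pos v) ∩ (K (c u)).toSet).Nonempty := by
      intro u v hc huv
      have huv' : ((σ u : ℕ) : ℝ) + 1 ≤ σ v := by exact_mod_cast huv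
      have h := chords_inter_nonempty (center (c u)) (a := ε * (σ u : ℕ)) (c := s u)
        (b := ε * ((σ u + 1 : ℕ) : ℝ)) (d := s v)
        (mul_lt_mul_of_pos_left (by linarith) hε0)
        (mul_lt_mul_of_pos_left (by push_cast; linarith) hε0)
        (mul_lt_mul_of_pos_left (by push_cast; linarith) hε0)
      have hpv : pos v = parabolaPoint (center (c u)) (s v) := by simp only [pos, hc]
      rw [hpv]
      refine h.mono (Set.inter_subset_inter_right _ ?_)
      exact segment_subset_parabolaPolygon (center (c u)) (n := N + 3) (by omega) hoK
        (by have := hσN u; omega)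
    have cross : ∀ u v, c u < c v → ¬ G.Adj u v →
        ∃ i, (segment ℝ (pos u) (pos v) ∩ (obs i).toSet).Nonempty := by
      intro u v hc h
      let e : {e : Fin m × Fin m // e.1 < e.2} := ⟨(c u, c v), hc⟩
      refine ⟨Sum.inl ⟨e, fun u' v' hu' hv' h' => h ?_⟩, ?_⟩
      · rw [twin u u' v hu'.symm, G.adj_comm, twin v v' u' hv'.symm, G.adj_comm]
        exact h'
      · obtain ⟨y, hy, hy1, hy2⟩ := F7 e _ (hposρ u) _ (hposρ v)
        refine ⟨y, hy, segment_subset_parabolaPolygon _ le_rfl hoB (j := 0) (by omega) ?_⟩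
        rw [mem_segment_parabolaPoint (hoB (Nat.lt_succ_self 0))]
        obtain ⟨h1, h2⟩ := abs_le.1 hy1
        refine ⟨?_, ?_, ?_⟩
        · norm_num
          linarith
        · norm_num
          linarith
        · norm_num
          rw [hy2]
          ring
    intro u v huv h
    rcases lt_trichotomy (c u) (c v) with hc | hc | hc
    · exact cross u v hc h
    · refine ⟨Sum.inr ⟨c u, single u v hc huv⟩, ?_⟩
      rcases lt_or_gt_of_ne (hσ.ne huv) with h' | h'
      · exact same u v hc h'
      · have := same v u hc.symm h'
        rwa [segment_symm, ← hc] at this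
    · obtain ⟨i, hi⟩ := cross v u hc fun h' => h h'.symm
      exact ⟨i, by rwa [segment_symm]⟩

/-- Obstacle representations restrict along embeddings of induced subgraphs. -/
theorem exists_obstacleRep_of_embedding {V W : Type*} {G : SimpleGraph V} {H : SimpleGraph W}
    (φ : G ↪g H) {h : ℕ} (hH : ∃ R : ObstacleRep H, R.numObs ≤ h) :
    ∃ R : ObstacleRep G, R.numObs ≤ h := by
  obtain ⟨R, hR⟩ := hH
  exact ⟨{
    pos := R.pos ∘ φ
    posInj := R.posInj.comp φ.injective
    genPos := fun u v w huv huw hvw => R.genPos _ _ _ (φ.injective.ne huv)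
      (φ.injective.ne huw) (φ.injective.ne hvw)
    numObs := R.numObs
    obs := R.obs
    disj := R.disj
    edges_clear := fun u v huv => R.edges_clear _ _ (φ.map_adj_iff.2 huv)
    nonedges_blocked := fun u v huv h' => R.nonedges_blocked _ _ (φ.injective.ne huv)
      (fun h'' => h' (φ.map_adj_iff.1 h'')) }, hR⟩

/-- Dickson's lemma: the minimal elements of a set of tuples of naturals are bounded. -/
theorem exists_bound_of_minimal {ι : Type*} [Finite ι] (U : Set (ι → ℕ)) :
    ∃ B : ℕ, ∀ s ∈ U, ∃ s' ∈ U, s' ≤ s ∧ ∀ i, s' i ≤ B := by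
  have hfin : {s | Minimal (· ∈ U) s}.Finite :=
    WellQuasiOrderedLE.finite_of_isAntichain (setOfPred_minimal_antichain _)
  obtain ⟨b, hb⟩ := hfin.bddAbove
  obtain ⟨B, hB⟩ := (Set.finite_range b).bddAbove
  refine ⟨B, fun s hs => ?_⟩
  obtain ⟨s', hle, hs'⟩ := exists_minimal_le_of_wellFoundedLT (· ∈ U) s hs
  exact ⟨s', hs'.prop, hle, fun i => (hb hs' i).trans (hB ⟨i, rfl⟩)⟩

section Trace

variable {V : Type*} {k : ℕ} (G : SimpleGraph V) (x : Fin k → V)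

/-- The indices of the points of the family `x` adjacent to `v`. -/
def trace (v : V) : Finset (Fin k) :=
  Finset.univ.filter fun i => G.Adj v (x i)

theorem mem_trace {v : V} {i : Fin k} : i ∈ trace G x v ↔ G.Adj v (x i) := by
  simp [trace]

variable {G x}

/-- Graphs with a vertex cover of size `k` have representations with boundedly many obstacles. -/
theorem exists_obstacleRep_of_vertexCover [Fintype V] (hx : Function.Injective x)
    (cover : ∀ u v, G.Adj u v → u ∈ Set.range x ∨ v ∈ Set.range x) :
    ∃ R : ObstacleRep G, R.numObs ≤ (2 ^ k + k) * (2 ^ k + k) + (2 ^ k + k) := by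
  let code : Finset (Fin k) ≃ Fin (2 ^ k) := Fintype.equivFinOfCardEq (by simp)
  let c : V → Fin (2 ^ k + k) := fun v =>
    if h : v ∈ Set.range x then Fin.natAdd (2 ^ k) h.choose
    else Fin.castAdd k (code (trace G x v))
  have c_cover : ∀ i, c (x i) = Fin.natAdd (2 ^ k) i := by
    intro i
    have h : x i ∈ Set.range x := ⟨i, rfl⟩
    simp only [c, dif_pos h]
    rw [hx h.choose_spec]
  have c_indep : ∀ v, v ∉ Set.range x → c v = Fin.castAdd k (code (trace G x v)) :=
    fun v h => dif_neg h
  have c_lt : ∀ v, (c v).val < 2 ^ k ↔ v ∉ Set.range x := by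
    intro v
    by_cases h : v ∈ Set.range x
    · obtain ⟨i, rfl⟩ := h
      simp [c_cover]
    · simp [c_indep v h, h]
  have c_eq : ∀ u v, c u = c v → u ≠ v →
      u ∉ Set.range x ∧ v ∉ Set.range x ∧ trace G x u = trace G x v := by
    intro u v huv hne
    have hu : u ∉ Set.range x := by
      intro hu
      have hv : v ∈ Set.range x := by
        by_contra hv
        rw [← c_lt, ← huv, c_lt] at hv
        exact hv hu
      obtain ⟨i, rfl⟩ := hu
      obtain ⟨j, rfl⟩ := hv
      rw [c_cover, c_cover] at huv
      exact hne (congrArg x (by simpa using huv))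
    have hv : v ∉ Set.range x := by rwa [← c_lt, ← huv, c_lt]
    rw [c_indep u hu, c_indep v hv] at huv
    exact ⟨hu, hv, by simpa using huv⟩
  refine exists_obstacleRep_of_twin_classes G (2 ^ k + k) c {q | q.val < 2 ^ k} ?_ ?_ ?_
  · intro u v w huv
    by_cases hne : u = v
    · rw [hne]
    obtain ⟨hu, hv, ht⟩ := c_eq u v huv hne
    by_cases hw : w ∈ Set.range x
    · obtain ⟨i, rfl⟩ := hw
      rw [← mem_trace, ← mem_trace, ht]
    · exact ⟨fun h => ((cover _ _ h).elim hu hw).elim, fun h => ((cover _ _ h).elim hv hw).elim⟩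
  · intro u v hu h
    rw [Set.mem_ofPred_eq] at hu
    have hv := (cover u v h).resolve_left ((c_lt u).1 hu)
    rw [← not_not (a := v ∈ _), ← c_lt] at hv
    exact Fin.lt_def.2 (by omega)
  · intro u v huv hne
    rw [Set.mem_ofPred_eq, c_lt]
    exact (c_eq u v huv hne).1

/-- The graph with cover part `A` and, for each `S`, exactly `s S` independent vertices whose
neighborhood is the subset `S` of the cover part. -/
def modelGraph (A : SimpleGraph (Fin k)) (s : Finset (Fin k) → ℕ) :
    SimpleGraph (Fin k ⊕ Σ S, Fin (s S)) where
  Adj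
    | .inl i, .inl j => A.Adj i j
    | .inl i, .inr p => i ∈ p.1
    | .inr p, .inl i => i ∈ p.1
    | .inr _, .inr _ => False
  symm := ⟨by
    rintro (i | p) (j | q) h
    exacts [SimpleGraph.Adj.symm h, h, h, h]⟩
  loopless := ⟨by
    rintro (i | p) h
    exacts [A.irrefl h, h]⟩

/-- Choosing `s S` vertices of trace `S` for every `S` embeds the model graph. -/
def modelGraphEmbedding (hx : Function.Injective x)
    (cover : ∀ u v, G.Adj u v → u ∈ Set.range x ∨ v ∈ Set.range x)
    {s : Finset (Fin k) → ℕ}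
    (g : ∀ S, Fin (s S) ↪ {v // v ∉ Set.range x ∧ trace G x v = S}) :
    modelGraph (G.comap x) s ↪g G where
  toFun := Sum.elim x fun p => (g p.1 p.2).1
  inj' := by
    rintro (i | ⟨S, a⟩) (j | ⟨S', b⟩) h
    · exact congrArg _ (hx h)
    · exact ((g S' b).2.1 ⟨i, h⟩).elim
    · exact ((g S a).2.1 ⟨j, h.symm⟩).elim
    · have h' : (g S a).1 = (g S' b).1 := h
      obtain rfl : S = S' := by rw [← (g S a).2.2, ← (g S' b).2.2, h']
      rw [(g S).injective (Subtype.ext h')]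
  map_rel_iff' := by
    rintro (i | ⟨S, a⟩) (j | ⟨S', b⟩)
    · exact Iff.rfl
    · change G.Adj (x i) (g S' b).1 ↔ i ∈ S'
      rw [G.adj_comm, ← mem_trace, (g S' b).2.2]
    · change G.Adj (g S a).1 (x j) ↔ j ∈ S
      rw [← mem_trace, (g S a).2.2]
    · exact ⟨fun h => ((cover _ _ h).elim (g S a).2.1 (g S' b).2.1).elim, False.elim⟩

/-- A graph with vertex cover `x` embeds in the model graph recording its trace counts. -/
theorem nonempty_embedding_modelGraph [Fintype V] (hx : Function.Injective x)
    (cover : ∀ u v, G.Adj u v → u ∈ Set.range x ∨ v ∈ Set.range x) :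
    Nonempty (G ↪g modelGraph (G.comap x)
      fun S => Fintype.card {v // v ∉ Set.range x ∧ trace G x v = S}) := by
  let e : ∀ S, {v // v ∉ Set.range x ∧ trace G x v = S} ≃ Fin _ := fun S => Fintype.equivFin _
  let φ := modelGraphEmbedding hx cover fun S => (e S).symm.toEmbedding
  have hφ : Function.Surjective φ := by
    intro v
    by_cases hv : v ∈ Set.range x
    · obtain ⟨i, rfl⟩ := hv
      exact ⟨.inl i, rfl⟩
    · refine ⟨.inr ⟨trace G x v, e _ ⟨v, hv, rfl⟩⟩, ?_⟩
      exact congrArg Subtype.val ((e _).symm_apply_apply ⟨v, hv, rfl⟩)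
  exact ⟨(RelIso.ofSurjective φ hφ).symm.toRelEmbedding⟩

end Trace

/-- For fixed `k`, graphs whose model needs more than `h` obstacles contain such a model with
bounded multiplicities, uniformly in the cover part and in `h` below any given bound. -/
theorem exists_multiplicity_bound (k n : ℕ) :
    ∃ B : ℕ, ∀ (A : SimpleGraph (Fin k)) (h : ℕ), h < n → ∀ s : Finset (Fin k) → ℕ,
      (¬ ∃ R : ObstacleRep (modelGraph A s), R.numObs ≤ h) →
      ∃ s' : Finset (Fin k) → ℕ, (¬ ∃ R : ObstacleRep (modelGraph A s'), R.numObs ≤ h) ∧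
        s' ≤ s ∧ ∀ S, s' S ≤ B := by
  choose b hb using fun p : SimpleGraph (Fin k) × Fin n => exists_bound_of_minimal
    {s : Finset (Fin k) → ℕ | ¬ ∃ R : ObstacleRep (modelGraph p.1 s), R.numObs ≤ p.2}
  obtain ⟨B, hB⟩ := (Set.finite_range b).bddAbove
  refine ⟨B, fun A h hn s hs => ?_⟩
  obtain ⟨s', hs', hle, hbd⟩ := hb (A, ⟨h, hn⟩) s hs
  exact ⟨s', hs', hle, fun S => (hbd S).trans (hB ⟨_, rfl⟩)⟩

end ObstaclePruning

/-- The pruning step: there is a function `f` such that whenever a graph `G` has a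
vertex cover `X` of size `k` and a set `T` of vertices outside `X` all sharing the
same non-empty neighborhood with `|T| > f(k)`, deleting any vertex `z ∈ T` does not
change whether `G` can be represented with at most `h` obstacles. -/
theorem obstacle_number_pruning :
    ∃ f : ℕ → ℕ, ∀ (V : Type) [Fintype V] (G : SimpleGraph V) (X T : Finset V),
      (∀ u v : V, G.Adj u v → u ∈ X ∨ v ∈ X) →
      Disjoint X T →
      (∀ a ∈ T, ∀ b ∈ T, ∀ w : V, G.Adj a w ↔ G.Adj b w) →
      (∀ a ∈ T, ∃ w : V, G.Adj a w) →
      f X.card < T.card →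
      ∀ z ∈ T, ∀ h : ℕ,
        ((∃ R : ObstacleRep G, R.numObs ≤ h) ↔
          (∃ R' : ObstacleRep (G.induce {v : V | v ≠ z}), R'.numObs ≤ h)) := by
  choose f hf using fun k => ObstaclePruning.exists_multiplicity_bound k
    ((2 ^ k + k) * (2 ^ k + k) + (2 ^ k + k))
  refine ⟨f, fun V _ G X T cover hXT twin _ hT z hz h => ⟨
    ObstaclePruning.exists_obstacleRep_of_embedding (SimpleGraph.Embedding.induce _),
    fun hR => ?_⟩⟩
  let x : Fin X.card → V := fun i => (X.equivFin.symm i).1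
  have hx : Function.Injective x := Subtype.val_injective.comp X.equivFin.symm.injective
  have range_x : ∀ v, v ∈ Set.range x ↔ v ∈ X := by
    refine fun v => ⟨?_, fun hv => ⟨X.equivFin ⟨v, hv⟩, by simp [x]⟩⟩
    rintro ⟨i, rfl⟩
    exact (X.equivFin.symm i).2
  replace cover : ∀ u v, G.Adj u v → u ∈ Set.range x ∨ v ∈ Set.range x := by
    simpa only [range_x] using cover
  by_contra hG
  obtain hh | hh := lt_or_ge h ((2 ^ X.card + X.card) * (2 ^ X.card + X.card) +
    (2 ^ X.card + X.card))
  swap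
  · obtain ⟨R, hR'⟩ := ObstaclePruning.exists_obstacleRep_of_vertexCover hx cover
    exact hG ⟨R, hR'.trans hh⟩
  obtain ⟨φ⟩ := ObstaclePruning.nonempty_embedding_modelGraph hx cover
  obtain ⟨s, hs, hle, hbd⟩ := hf X.card (G.comap x) h hh _
    fun hM => hG (ObstaclePruning.exists_obstacleRep_of_embedding φ hM)
  refine hs (ObstaclePruning.exists_obstacleRep_of_embedding ?_ hR)
  have notMem_of_mem : ∀ v ∈ T, v ∉ Set.range x := fun v hv h' =>
    Finset.disjoint_left.1 hXT ((range_x v).1 h') hv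
  have fiber : ∀ S, Nonempty (Fin (s S) ↪ {w : {v // v ∉ Set.range x ∧
      ObstaclePruning.trace G x v = S} // w.1 ≠ z}) := by
    intro S
    apply Function.Embedding.nonempty_of_card_le
    rw [Fintype.card_fin]
    by_cases hS : ObstaclePruning.trace G x z = S
    · have hcard : s S ≤ Fintype.card (T.erase z) := by
        rw [Fintype.card_coe, Finset.card_erase_of_mem hz]
        have := hbd S
        omega
      have htrace : ∀ v ∈ T, ObstaclePruning.trace G x v = S := by
        intro v hv
        ext i
        rw [← hS, ObstaclePruning.mem_trace, ObstaclePruning.mem_trace, twin v hv z hz]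
      refine hcard.trans (Fintype.card_le_of_injective (fun v => ⟨⟨v.1, notMem_of_mem v.1
        (Finset.mem_of_mem_erase v.2), htrace v.1 (Finset.mem_of_mem_erase v.2)⟩,
        Finset.ne_of_mem_erase v.2⟩) fun u v huv => ?_)
      exact Subtype.ext (congrArg (fun w => w.1.1) huv)
    · refine (hle S).trans (Fintype.card_le_of_injective
        (fun w => ⟨w, fun hw => hS (hw ▸ w.2.2)⟩) fun u v huv => ?_)
      exact congrArg Subtype.val huv
  let g := fun S => (fiber S).some
  let ψ := ObstaclePruning.modelGraphEmbedding hx cover fun S =>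
    (g S).trans (Function.Embedding.subtype _)
  have hψ : ∀ p, ψ p ≠ z := by
    rintro (i | p)
    · exact fun h' => notMem_of_mem z hz ⟨i, h'⟩
    · exact (g p.1 p.2).2
  exact
    { toFun := fun p => ⟨ψ p, hψ p⟩
      inj' := fun p q hpq => ψ.injective (congrArg Subtype.val hpq)
      map_rel_iff' := ψ.map_rel_iff }
end
end
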